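/- arXiv:1201.2778 — 2 statements merged into one kernel-verified Lean document; each statement's English description precedes it below -/
import Mathlib

section
/- Let γ : ℝ → ℝ³ be a C^∞ curve such that γ'(0), γ''(0), γ'''(0) are linearly independent (i.e. γ has type (1,2,3) at 0). Then the tangent map-germ Tan(γ) : (ℝ², (0,0)) → ℝ³, Tan(γ)(s,t) = γ(t) + s·γ'(t), is diffeomorphic (right–left equivalent) to the cuspidal edge map-germ (u,x) ↦ (u, x², x³) at 0. -/
open Filter Topology
/-- Two map-germs `f` at `a` and `g` at `b` are diffeomorphic (right-left equivalent):
there are germs of `C^∞` diffeomorphisms `σ : (E, a) → (E, b)` and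
`τ : (F, f a) → (F, g b)` with `g ∘ σ = τ ∘ f` as germs at `a`. -/
def GermEquiv {E F : Type*} [NormedAddCommGroup E] [NormedSpace ℝ E]
    [NormedAddCommGroup F] [NormedSpace ℝ F]
    (f : E → F) (a : E) (g : E → F) (b : E) : Prop :=
  ∃ σ σinv : E → E, ∃ τ τinv : F → F,
    σ a = b ∧ τ (f a) = g b ∧
    ContDiffAt ℝ (⊤ : ℕ∞) σ a ∧ ContDiffAt ℝ (⊤ : ℕ∞) σinv b ∧
    ContDiffAt ℝ (⊤ : ℕ∞) τ (f a) ∧ ContDiffAt ℝ (⊤ : ℕ∞) τinv (g b) ∧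
    (∀ᶠ x in 𝓝 a, σinv (σ x) = x) ∧ (∀ᶠ y in 𝓝 b, σ (σinv y) = y) ∧
    (∀ᶠ z in 𝓝 (f a), τinv (τ z) = z) ∧ (∀ᶠ w in 𝓝 (g b), τ (τinv w) = w) ∧
    (∀ᶠ x in 𝓝 a, g (σ x) = τ (f x))

section CuspidalEdgeAux
open MeasureTheory


/-- continuous partial derivatives of class `C^n` imply `C^(n+1)`. -/
lemma contDiff_step {f f1 f2 : ℝ × ℝ → ℝ} {n : ℕ}
    (d1 : ∀ u y, HasDerivAt (fun u => f (u, y)) (f1 (u, y)) u)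
    (d2 : ∀ u y, HasDerivAt (fun y => f (u, y)) (f2 (u, y)) y)
    (c1 : ContDiff ℝ n f1) (c2 : ContDiff ℝ n f2) : ContDiff ℝ (n + 1 : ℕ) f := by
  have key : ∀ p : ℝ × ℝ, HasFDerivAt f
      ((ContinuousLinearMap.toSpanSingleton ℝ (f1 p)).coprod
        (ContinuousLinearMap.toSpanSingleton ℝ (f2 p))) p := by
    intro p
    have := hasStrictFDerivAt_uncurry_coprod (𝕜 := ℝ) (u := p) (f := fun u y => f (u, y))
      (f₁ := fun u y => ContinuousLinearMap.toSpanSingleton ℝ (f1 (u, y)))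
      (f₂ := fun u y => ContinuousLinearMap.toSpanSingleton ℝ (f2 (u, y)))
      (Eventually.of_forall fun v => (d1 v.1 v.2).hasFDerivAt)
      (Eventually.of_forall fun v => (d2 v.1 v.2).hasFDerivAt)
      (by
        have h : Continuous (fun p : ℝ × ℝ => ContinuousLinearMap.toSpanSingleton ℝ (f1 p)) :=
          (ContinuousLinearMap.toSpanSingletonLIE ℝ ℝ).continuous.comp c1.continuous
        exact h.continuousAt)
      (by
        have h : Continuous (fun p : ℝ × ℝ => ContinuousLinearMap.toSpanSingleton ℝ (f2 p)) :=
          (ContinuousLinearMap.toSpanSingletonLIE ℝ ℝ).continuous.comp c2.continuous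
        exact h.continuousAt)
    exact this.hasFDerivAt
  have hfd : fderiv ℝ f = fun p => (f1 p) • ContinuousLinearMap.fst ℝ ℝ ℝ +
      (f2 p) • ContinuousLinearMap.snd ℝ ℝ ℝ := by
    funext p
    rw [(key p).fderiv]
    ext <;> simp
  push_cast
  rw [contDiff_succ_iff_fderiv]
  refine ⟨fun p => (key p).differentiableAt, by simp, ?_⟩
  rw [hfd]
  fun_prop

/-- weighted dilation integral -/
noncomputable def KI (w : ℝ → ℝ) (h : ℝ × ℝ → ℝ) (p : ℝ × ℝ) : ℝ :=
  ∫ l, w l * h (p.1, l * p.2)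

noncomputable def pu (h : ℝ × ℝ → ℝ) (p : ℝ × ℝ) : ℝ := fderiv ℝ h p (1, 0)
noncomputable def px (h : ℝ × ℝ → ℝ) (p : ℝ × ℝ) : ℝ := fderiv ℝ h p (0, 1)

lemma pu_smooth {h : ℝ × ℝ → ℝ} (hh : ContDiff ℝ (⊤ : ℕ∞) h) : ContDiff ℝ (⊤ : ℕ∞) (pu h) :=
  (hh.fderiv_right (m := (⊤ : ℕ∞)) (by simp)).clm_apply contDiff_const

lemma px_smooth {h : ℝ × ℝ → ℝ} (hh : ContDiff ℝ (⊤ : ℕ∞) h) : ContDiff ℝ (⊤ : ℕ∞) (px h) :=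
  (hh.fderiv_right (m := (⊤ : ℕ∞)) (by simp)).clm_apply contDiff_const

lemma pu_deriv {h : ℝ × ℝ → ℝ} (hh : ContDiff ℝ (⊤ : ℕ∞) h) (u x : ℝ) :
    HasDerivAt (fun u => h (u, x)) (pu h (u, x)) u := by
  have h1 := (hh.differentiable (by simp) (u, x)).hasFDerivAt
  exact h1.comp_hasDerivAt u ((hasDerivAt_id u).prodMk (hasDerivAt_const u x))

lemma px_deriv {h : ℝ × ℝ → ℝ} (hh : ContDiff ℝ (⊤ : ℕ∞) h) (u x : ℝ) :
    HasDerivAt (fun x => h (u, x)) (px h (u, x)) x := by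
  have h1 := (hh.differentiable (by simp) (u, x)).hasFDerivAt
  exact h1.comp_hasDerivAt x ((hasDerivAt_const x u).prodMk (hasDerivAt_id x))

def Adm (w : ℝ → ℝ) (h : ℝ × ℝ → ℝ) : Prop :=
  (∀ n : ℕ, Integrable (fun l => l ^ n * w l)) ∧
    ((∀ l, 1 < |l| → w l = 0) ∨ HasCompactSupport h)

lemma Adm.pu {w h} (a : Adm w h) : Adm w (pu h) :=
  ⟨a.1, a.2.imp id fun c => c.fderiv_apply ℝ _⟩

lemma Adm.px {w h} (a : Adm w h) : Adm (fun l => l * w l) (px h) :=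
  ⟨fun n => by simpa [pow_succ, mul_assoc] using a.1 (n + 1),
   a.2.imp (fun c l hl => by simp [c l hl]) fun c => c.fderiv_apply ℝ _⟩

lemma Adm.int {w h} (a : Adm w h) : Integrable w := by simpa using a.1 0

lemma Adm.bound {w h} (a : Adm w h) (hc : Continuous h) (R : ℝ) :
    ∃ B, ∀ p : ℝ × ℝ, ‖p‖ ≤ R → ∀ l, ‖w l * h (p.1, l * p.2)‖ ≤ B * ‖w l‖ := by
  rcases a.2 with c | c
  · obtain ⟨B, hB⟩ := (isCompact_closedBall (0 : ℝ × ℝ) R).exists_bound_of_continuousOn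
      hc.continuousOn
    refine ⟨B, fun p hp l => ?_⟩
    by_cases hl : 1 < |l|
    · simp [c l hl]
    · rw [norm_mul, mul_comm]
      gcongr
      apply hB
      simp only [mem_closedBall_zero_iff, Prod.norm_def, sup_le_iff] at hp ⊢
      refine ⟨hp.1, ?_⟩
      rw [norm_mul]
      push Not at hl
      calc ‖l‖ * ‖p.2‖ ≤ 1 * ‖p.2‖ := by gcongr; exact hl
        _ ≤ R := by simpa using hp.2
  · obtain ⟨B, hB⟩ := hc.bounded_above_of_compact_support c
    refine ⟨B, fun p hp l => ?_⟩
    rw [norm_mul, mul_comm]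
    gcongr
    apply hB

lemma KI_meas {w h} (a : Adm w h) (hc : Continuous h) (p : ℝ × ℝ) :
    AEStronglyMeasurable (fun l => w l * h (p.1, l * p.2)) volume :=
  a.int.1.mul (by fun_prop : Continuous fun l => h (p.1, l * p.2)).aestronglyMeasurable

lemma KI_int {w h} (a : Adm w h) (hc : Continuous h) (p : ℝ × ℝ) :
    Integrable (fun l => w l * h (p.1, l * p.2)) volume := by
  obtain ⟨B, hB⟩ := a.bound hc ‖p‖
  exact (a.int.norm.const_mul B).mono' (KI_meas a hc p)
    (Eventually.of_forall fun l => hB p le_rfl l)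

lemma KI_cont {w h} (a : Adm w h) (hc : Continuous h) : Continuous (KI w h) := by
  rw [continuous_iff_continuousAt]
  intro p
  obtain ⟨B, hB⟩ := a.bound hc (‖p‖ + 1)
  refine continuousAt_of_dominated (bound := fun l => B * ‖w l‖)
    (Eventually.of_forall fun q => KI_meas a hc q) ?_ (a.int.norm.const_mul B)
    (Eventually.of_forall fun l => by fun_prop)
  have : ∀ᶠ q in 𝓝 p, ‖q‖ < ‖p‖ + 1 :=
    continuous_norm.continuousAt.eventually_lt continuousAt_const (by simp)
  filter_upwards [this] with q hq
  exact Eventually.of_forall fun l => hB q hq.le l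

lemma KI_du {w h} (a : Adm w h) (hh : ContDiff ℝ (⊤ : ℕ∞) h) (u s : ℝ) :
    HasDerivAt (fun u => KI w h (u, s)) (KI w (pu h) (u, s)) u := by
  have hc := hh.continuous
  have hc' := (pu_smooth hh).continuous
  obtain ⟨B, hB⟩ := a.pu.bound hc' (‖((u, s) : ℝ × ℝ)‖ + 1)
  have hs : {v : ℝ | ‖((v, s) : ℝ × ℝ)‖ < ‖((u, s) : ℝ × ℝ)‖ + 1} ∈ 𝓝 u := by
    apply ContinuousAt.eventually_lt (by fun_prop) continuousAt_const (by simp)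
  refine (hasDerivAt_integral_of_dominated_loc_of_deriv_le (μ := volume)
    (F := fun v l => w l * h (v, l * s)) (F' := fun v l => w l * pu h (v, l * s))
    (bound := fun l => B * ‖w l‖) hs
    (Eventually.of_forall fun v => KI_meas a hc (v, s)) (KI_int a hc (u, s))
    (KI_meas a.pu hc' (u, s))
    (Eventually.of_forall fun l v hv => hB (v, s) (le_of_lt hv) l) (a.int.norm.const_mul B)
    (Eventually.of_forall fun l v hv => (pu_deriv hh v (l * s)).const_mul (w l))).2

lemma KI_dx {w h} (a : Adm w h) (hh : ContDiff ℝ (⊤ : ℕ∞) h) (u s : ℝ) :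
    HasDerivAt (fun s => KI w h (u, s)) (KI (fun l => l * w l) (px h) (u, s)) s := by
  have hc := hh.continuous
  have hc' := (px_smooth hh).continuous
  obtain ⟨B, hB⟩ := a.px.bound hc' (‖((u, s) : ℝ × ℝ)‖ + 1)
  have hs : {v : ℝ | ‖((u, v) : ℝ × ℝ)‖ < ‖((u, s) : ℝ × ℝ)‖ + 1} ∈ 𝓝 s := by
    apply ContinuousAt.eventually_lt (by fun_prop) continuousAt_const (by simp)
  refine (hasDerivAt_integral_of_dominated_loc_of_deriv_le (μ := volume)
    (F := fun v l => w l * h (u, l * v)) (F' := fun v l => (l * w l) * px h (u, l * v))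
    (bound := fun l => B * ‖l * w l‖) hs
    (Eventually.of_forall fun v => KI_meas a hc (u, v)) (KI_int a hc (u, s))
    (KI_meas a.px hc' (u, s))
    (Eventually.of_forall fun l v hv => hB (u, v) (le_of_lt hv) l) (a.px.int.norm.const_mul B)
    (Eventually.of_forall fun l v hv => ?_)).2
  have := ((px_deriv hh u (l * v)).comp v ((hasDerivAt_id v).const_mul l)).const_mul (w l)
  exact this.congr_deriv (by ring)

lemma KI_smooth {w h} (a : Adm w h) (hh : ContDiff ℝ (⊤ : ℕ∞) h) :
    ContDiff ℝ (⊤ : ℕ∞) (KI w h) := by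
  rw [contDiff_infty]
  intro n
  induction n generalizing w h with
  | zero => exact contDiff_zero.2 (KI_cont a hh.continuous)
  | succ n ih =>
    exact contDiff_step (KI_du a hh) (KI_dx a hh) (ih a.pu (pu_smooth hh)) (ih a.px (px_smooth hh))

lemma exists_moments : ∃ ψ : ℝ → ℝ, (∀ n : ℕ, Integrable (fun l => l ^ n * ψ l)) ∧
    ∀ m : ℕ, ∫ l, (-(l ^ 2)) ^ m * ψ l = 1 := by
  classical
  let χ : ContDiffBump (0 : ℝ) := ⟨1, 2, by norm_num, by norm_num⟩
  let φ : ℝ → ℂ := fun x => ((χ x * Real.exp (2 * Real.pi * x) : ℝ) : ℂ)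
  have hφ : ContDiff ℝ (⊤ : ℕ∞) φ := by
    have h1 : ContDiff ℝ (⊤ : ℕ∞) (fun x : ℝ => χ x * Real.exp (2 * Real.pi * x)) :=
      χ.contDiff.mul (by fun_prop)
    exact Complex.ofRealCLM.contDiff.comp h1
  have hφc : HasCompactSupport φ := by
    have h1 : HasCompactSupport (fun x : ℝ => χ x * Real.exp (2 * Real.pi * x)) :=
      χ.hasCompactSupport.mul_right
    exact h1.comp_left (g := fun x : ℝ => (x : ℂ)) (by simp)
  let Φ : SchwartzMap ℝ ℂ := hφc.toSchwartzMap hφ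
  let Ψ : SchwartzMap ℝ ℂ := FourierTransformInv.fourierInv Φ
  have hFT : FourierTransform.fourier (Ψ : ℝ → ℂ) = φ := by
    rw [← SchwartzMap.fourier_coe]
    simp only [Ψ, FourierTransform.fourier_fourierInv_eq]
    rfl
  have hint : ∀ n : ℕ, Integrable (fun x : ℝ => x ^ n • Ψ x) := by
    intro n
    refine (Ψ.integrable_pow_mul volume n).mono' ?_ ?_
    · exact (by fun_prop : Continuous fun x : ℝ => x ^ n • Ψ x).aestronglyMeasurable
    · exact Eventually.of_forall fun x => by simp
  have hder : ∀ m : ℕ, iteratedDeriv (2 * m) φ 0 = ((2 * Real.pi : ℝ) : ℂ) ^ (2 * m) := by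
    intro m
    have he : φ =ᶠ[𝓝 0] fun x : ℝ => ((Real.exp (2 * Real.pi * x) : ℝ) : ℂ) := by
      filter_upwards [χ.eventuallyEq_one] with x hx
      simp only [φ, hx]; simp
    rw [he.iteratedDeriv_eq]
    have : ∀ n : ℕ, iteratedDeriv n (fun x : ℝ => ((Real.exp (2 * Real.pi * x) : ℝ) : ℂ))
        = fun x : ℝ => ((2 * Real.pi : ℝ) : ℂ) ^ n * ((Real.exp (2 * Real.pi * x) : ℝ) : ℂ) := by
      intro n
      induction n with
      | zero => simp
      | succ n ih =>
        rw [iteratedDeriv_succ, ih]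
        funext x
        have h1 : HasDerivAt (fun x : ℝ => Real.exp (2 * Real.pi * x))
            (Real.exp (2 * Real.pi * x) * (2 * Real.pi * 1)) x :=
          ((hasDerivAt_id x).const_mul (2 * Real.pi)).exp
        rw [(h1.ofReal_comp.const_mul _).deriv]
        push_cast; ring
    rw [this]; simp
  have hmom : ∀ m : ℕ, ∫ l : ℝ, (((-(l ^ 2)) ^ m : ℝ) : ℂ) * Ψ l = 1 := by
    intro m
    have h1 := Real.iteratedDeriv_fourier (f := (Ψ : ℝ → ℂ)) (N := ⊤) (n := 2 * m)
      (fun n _ => hint n) le_top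
    have h2 := congrFun h1 0
    rw [hFT, hder, Real.fourier_eq] at h2
    have h3 : ∀ v : ℝ, (-2 * (Real.pi : ℂ) * Complex.I * v) ^ (2 * m) • Ψ v
        = ((2 * Real.pi : ℝ) : ℂ) ^ (2 * m) * ((((-(v ^ 2)) ^ m : ℝ) : ℂ) * Ψ v) := by
      intro v
      rw [pow_mul, pow_mul, smul_eq_mul, ← mul_assoc]
      congr 1
      push_cast
      rw [← mul_pow]
      congr 1
      ring_nf
      rw [Complex.I_sq]; ring
    simp only [h3, inner_zero_right, neg_zero] at h2
    simp only [AddChar.map_zero_eq_one, one_smul, integral_const_mul] at h2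
    have hne : ((2 * Real.pi : ℝ) : ℂ) ^ (2 * m) ≠ 0 := by
      apply pow_ne_zero
      exact_mod_cast (by positivity : (2 * Real.pi : ℝ) ≠ 0)
    exact (mul_left_cancel₀ hne (by rw [mul_one]; exact h2)).symm
  refine ⟨fun l => (Ψ l).re, fun n => ?_, fun m => ?_⟩
  · have := (hint n).re
    refine this.congr (Eventually.of_forall fun l => ?_)
    simp only [Complex.real_smul, RCLike.re_eq_complex_re, Complex.re_ofReal_mul]
  · have hi : Integrable (fun l : ℝ => (((-(l ^ 2)) ^ m : ℝ) : ℂ) * Ψ l) := by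
      have := (hint (2 * m)).const_mul ((-1 : ℂ) ^ m)
      refine this.congr (Eventually.of_forall fun l => ?_)
      simp only [Complex.real_smul]
      push_cast
      rw [neg_pow, pow_mul]; ring
    have h1 := integral_re hi
    rw [hmom m] at h1
    simpa only [RCLike.re_eq_complex_re, Complex.re_ofReal_mul, Complex.one_re] using h1

lemma Adm.unit (h : ℝ × ℝ → ℝ) (n : ℕ) :
    Adm (Set.indicator (Set.Icc 0 1) fun l => l ^ n) h := by
  refine ⟨fun k => ?_, Or.inl fun l hl => ?_⟩
  · have : (fun l : ℝ => l ^ k * (Set.Icc 0 1).indicator (fun l => l ^ n) l)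
      = (Set.Icc 0 1).indicator (fun l => l ^ k * l ^ n) := by
      funext l
      by_cases hl : l ∈ Set.Icc (0 : ℝ) 1 <;> simp [hl]
    rw [this, integrable_indicator_iff measurableSet_Icc]
    exact (by fun_prop : Continuous fun l : ℝ => l ^ k * l ^ n).continuousOn.integrableOn_Icc
  · apply Set.indicator_of_notMem
    intro h
    rw [abs_of_nonneg h.1] at hl
    exact absurd h.2 (not_le.2 hl)

lemma KI_unit (h : ℝ × ℝ → ℝ) (n : ℕ) (p : ℝ × ℝ) :
    KI (Set.indicator (Set.Icc 0 1) fun l => l ^ n) h p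
      = ∫ l in (0 : ℝ)..1, l ^ n * h (p.1, l * p.2) := by
  rw [intervalIntegral.integral_of_le zero_le_one, ← integral_Icc_eq_integral_Ioc,
    ← integral_indicator measurableSet_Icc]
  unfold KI
  congr 1
  funext l
  by_cases hl : l ∈ Set.Icc (0 : ℝ) 1 <;> simp [hl]

/-- Hadamard quotient -/
noncomputable def had (h : ℝ × ℝ → ℝ) : ℝ × ℝ → ℝ :=
  KI (Set.indicator (Set.Icc 0 1) fun l => l ^ 0) (px h)

lemma had_smooth {h : ℝ × ℝ → ℝ} (hh : ContDiff ℝ (⊤ : ℕ∞) h) : ContDiff ℝ (⊤ : ℕ∞) (had h) :=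
  KI_smooth (Adm.unit _ 0) (px_smooth hh)

lemma had_zero (h : ℝ × ℝ → ℝ) (u : ℝ) : had h (u, 0) = px h (u, 0) := by
  rw [had, KI_unit]; simp

lemma had_eq {h : ℝ × ℝ → ℝ} (hh : ContDiff ℝ (⊤ : ℕ∞) h) (u x : ℝ) :
    h (u, x) = h (u, 0) + x * had h (u, x) := by
  rw [had, KI_unit]
  have hc := (px_smooth hh).continuous
  have h1 : ∀ l ∈ Set.uIcc (0 : ℝ) 1,
      HasDerivAt (fun l => h (u, l * x)) (x * (l ^ 0 * px h (u, l * x))) l := by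
    intro l _
    have := (px_deriv hh u (l * x)).comp l ((hasDerivAt_id l).mul_const x)
    exact this.congr_deriv (by ring)
  have h2 := intervalIntegral.integral_eq_sub_of_hasDerivAt h1
    (by apply Continuous.intervalIntegrable; fun_prop)
  rw [intervalIntegral.integral_const_mul] at h2
  simp only [one_mul, zero_mul] at h2
  simp only
  linarith

lemma px_odd {h : ℝ × ℝ → ℝ} (hh : ContDiff ℝ (⊤ : ℕ∞) h) (hev : ∀ u x, h (u, -x) = h (u, x))
    (u x : ℝ) : px h (u, -x) = - px h (u, x) := by
  have h1 := (px_deriv hh u (-x)).comp x (hasDerivAt_neg x)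
  have h2 : ((fun x => h (u, x)) ∘ fun x => -x) = fun x => h (u, x) := by
    funext y; exact hev u y
  rw [h2] at h1
  have := h1.unique (px_deriv hh u x)
  linarith

lemma px_eq {h : ℝ × ℝ → ℝ} (hh : ContDiff ℝ (⊤ : ℕ∞) h) (hev : ∀ u x, h (u, -x) = h (u, x))
    (u x : ℝ) : px h (u, x) = x * had (px h) (u, x) := by
  have h0 := px_odd hh hev u 0
  rw [neg_zero] at h0
  rw [had_eq (px_smooth hh) u x]
  linarith

lemma had_even {h : ℝ × ℝ → ℝ} (hh : ContDiff ℝ (⊤ : ℕ∞) h) (hev : ∀ u x, h (u, -x) = h (u, x))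
    (u x : ℝ) : had (px h) (u, -x) = had (px h) (u, x) := by
  by_cases hx : x = 0
  · simp [hx]
  have h1 := px_eq hh hev u x
  have h2 := px_eq hh hev u (-x)
  rw [px_odd hh hev] at h2
  apply mul_left_cancel₀ hx
  linarith

lemma had_supp {h : ℝ × ℝ → ℝ} (hh : ContDiff ℝ (⊤ : ℕ∞) h) (hev : ∀ u x, h (u, -x) = h (u, x))
    (hc : HasCompactSupport h) : HasCompactSupport (had (px h)) := by
  have c1 : HasCompactSupport (px h) := hc.fderiv_apply ℝ _
  have c2 : HasCompactSupport (px (px h)) := c1.fderiv_apply ℝ _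
  obtain ⟨R, hR⟩ := (c1.isCompact.union c2.isCompact).isBounded.subset_closedBall 0
  have hR0 : ∀ p : ℝ × ℝ, R < ‖p‖ → px h p = 0 ∧ px (px h) p = 0 := by
    intro p hp
    constructor <;> (by_contra hne; apply not_lt.2 _ hp; rw [← mem_closedBall_zero_iff])
    · exact hR (Or.inl (subset_tsupport _ hne))
    · exact hR (Or.inr (subset_tsupport _ hne))
  refine HasCompactSupport.intro (isCompact_closedBall (0 : ℝ × ℝ) (max R 0)) ?_
  rintro ⟨u, x⟩ hp
  have hp' : R < ‖((u, x) : ℝ × ℝ)‖ ∧ 0 < ‖((u, x) : ℝ × ℝ)‖ := by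
    rwa [mem_closedBall_zero_iff, not_le, max_lt_iff] at hp
  by_cases hx : x = 0
  · subst hx
    rw [had_zero]
    exact (hR0 _ hp'.1).2
  · have := px_eq hh hev u x
    rw [(hR0 _ hp'.1).1] at this
    exact (mul_eq_zero.1 this.symm).resolve_left hx

noncomputable def GW (ψ : ℝ → ℝ) (m : ℕ) (h : ℝ × ℝ → ℝ) (p : ℝ × ℝ) : ℝ :=
  if 0 ≤ p.2 then h (p.1, √p.2) else KI (fun l => (-(l ^ 2)) ^ m * ψ l) h (p.1, √(-p.2))

lemma GW_adm {ψ : ℝ → ℝ} (hi : ∀ n : ℕ, Integrable (fun l => l ^ n * ψ l))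
    (m : ℕ) {h : ℝ × ℝ → ℝ} (hc : HasCompactSupport h) :
    Adm (fun l => (-(l ^ 2)) ^ m * ψ l) h := by
  refine ⟨fun n => ?_, Or.inr hc⟩
  refine ((hi (n + 2 * m)).const_mul ((-1) ^ m)).congr (Eventually.of_forall fun l => ?_)
  simp only
  rw [neg_pow, pow_add, pow_mul]; ring

lemma GW_cont {ψ : ℝ → ℝ} (hi : ∀ n : ℕ, Integrable (fun l => l ^ n * ψ l))
    (hm : ∀ m : ℕ, ∫ l, (-(l ^ 2)) ^ m * ψ l = 1)
    (m : ℕ) {h : ℝ × ℝ → ℝ} (hh : Continuous h) (hc : HasCompactSupport h) :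
    Continuous (GW ψ m h) := by
  have hk := KI_cont (GW_adm hi m hc) hh
  unfold GW
  refine Continuous.if_le (by fun_prop) (by fun_prop) continuous_const continuous_snd ?_
  intro p hp
  rw [← hp]
  simp only [Real.sqrt_zero, neg_zero, KI, mul_zero]
  rw [integral_mul_const, hm, one_mul]

lemma GW_du {ψ : ℝ → ℝ} (hi : ∀ n : ℕ, Integrable (fun l => l ^ n * ψ l))
    (m : ℕ) {h : ℝ × ℝ → ℝ} (hh : ContDiff ℝ (⊤ : ℕ∞) h) (hc : HasCompactSupport h)
    (u y : ℝ) : HasDerivAt (fun u => GW ψ m h (u, y)) (GW ψ m (pu h) (u, y)) u := by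
  unfold GW
  by_cases hy : 0 ≤ y
  · simp only [hy, if_true]
    exact pu_deriv hh u _
  · simp only [hy, if_false]
    exact KI_du (GW_adm hi m hc) hh u _

lemma GW_dy {ψ : ℝ → ℝ} (hi : ∀ n : ℕ, Integrable (fun l => l ^ n * ψ l))
    (hm : ∀ m : ℕ, ∫ l, (-(l ^ 2)) ^ m * ψ l = 1)
    (m : ℕ) {h : ℝ × ℝ → ℝ} (hh : ContDiff ℝ (⊤ : ℕ∞) h) (hc : HasCompactSupport h)
    (hev : ∀ u x, h (u, -x) = h (u, x)) (u y : ℝ) :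
    HasDerivAt (fun y => GW ψ m h (u, y))
      (GW ψ (m + 1) (fun p => had (px h) p * 2⁻¹) (u, y)) y := by
  have hs : ContDiff ℝ (⊤ : ℕ∞) (fun p => had (px h) p * 2⁻¹) :=
    (had_smooth (px_smooth hh)).mul contDiff_const
  have hcs : HasCompactSupport (fun p => had (px h) p * 2⁻¹) :=
    (had_supp hh hev hc).mul_right
  have hA := GW_cont hi hm m hh.continuous hc
  have hB := GW_cont hi hm (m + 1) hs.continuous hcs
  refine hasDerivAt_of_hasDerivAt_of_ne' (x := 0)
    (f := fun y => GW ψ m h (u, y))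
    (g := fun y => GW ψ (m + 1) (fun p => had (px h) p * 2⁻¹) (u, y))
    ?_ (by fun_prop) (by fun_prop) y
  intro y hy
  rcases lt_or_gt_of_ne hy with hy | hy
  · have he : (fun y => GW ψ m h (u, y)) =ᶠ[𝓝 y]
        fun y => KI (fun l => (-(l ^ 2)) ^ m * ψ l) h (u, √(-y)) := by
      filter_upwards [eventually_lt_nhds hy] with z hz
      simp [GW, not_le.2 hz]
    refine HasDerivAt.congr_of_eventuallyEq ?_ he
    have hpos : 0 < √(-y) := Real.sqrt_pos.2 (by linarith)
    have h1 := (KI_dx (GW_adm hi m hc) hh u (√(-y))).comp y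
      ((hasDerivAt_neg y).sqrt (by linarith))
    refine h1.congr_deriv ?_
    simp only [GW, not_le.2 hy, if_false, KI]
    rw [← integral_mul_const]
    congr 1
    funext l
    rw [px_eq hh hev]
    field_simp
    ring
  · have he : (fun y => GW ψ m h (u, y)) =ᶠ[𝓝 y] fun y => h (u, √y) := by
      filter_upwards [eventually_gt_nhds hy] with z hz
      simp [GW, hz.le]
    refine HasDerivAt.congr_of_eventuallyEq ?_ he
    have hpos : 0 < √y := Real.sqrt_pos.2 hy
    have h1 := (px_deriv hh u (√y)).comp y ((hasDerivAt_id y).sqrt hy.ne')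
    refine h1.congr_deriv ?_
    simp only [GW, hy.le, if_true]
    rw [px_eq hh hev]
    simp only [id]
    field_simp

lemma pu_even {h : ℝ × ℝ → ℝ} (hh : ContDiff ℝ (⊤ : ℕ∞) h) (hev : ∀ u x, h (u, -x) = h (u, x))
    (u x : ℝ) : pu h (u, -x) = pu h (u, x) := by
  have h1 := pu_deriv hh u (-x)
  simp only [hev] at h1
  exact h1.unique (pu_deriv hh u x)

lemma GW_smooth {ψ : ℝ → ℝ} (hi : ∀ n : ℕ, Integrable (fun l => l ^ n * ψ l))
    (hm : ∀ m : ℕ, ∫ l, (-(l ^ 2)) ^ m * ψ l = 1)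
    (m : ℕ) {h : ℝ × ℝ → ℝ} (hh : ContDiff ℝ (⊤ : ℕ∞) h) (hc : HasCompactSupport h)
    (hev : ∀ u x, h (u, -x) = h (u, x)) : ContDiff ℝ (⊤ : ℕ∞) (GW ψ m h) := by
  rw [contDiff_infty]
  intro n
  induction n generalizing m h with
  | zero => exact contDiff_zero.2 (GW_cont hi hm m hh.continuous hc)
  | succ n ih =>
    refine contDiff_step (GW_du hi m hh hc) (GW_dy hi hm m hh hc hev)
      (ih m (pu_smooth hh) (hc.fderiv_apply ℝ _) (pu_even hh hev))
      (ih (m + 1) ((had_smooth (px_smooth hh)).mul contDiff_const)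
        (had_supp hh hev hc).mul_right fun u x => ?_)
    simp only [had_even hh hev]

/-- Whitney's even function theorem, with a parameter, near the origin. -/
lemma whitney_even {h : ℝ × ℝ → ℝ} (hh : ContDiff ℝ (⊤ : ℕ∞) h)
    (hev : ∀ u x, h (u, -x) = h (u, x)) :
    ∃ g : ℝ × ℝ → ℝ, ContDiff ℝ (⊤ : ℕ∞) g ∧
      ∀ u x, |u| ≤ 1 → |x| ≤ 1 → h (u, x) = g (u, x ^ 2) := by
  obtain ⟨ψ, hi, hm⟩ := exists_moments
  let χ : ContDiffBump (0 : ℝ) := ⟨1, 2, by norm_num, by norm_num⟩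
  let H : ℝ × ℝ → ℝ := fun p => χ p.1 * χ p.2 * h p
  have hH : ContDiff ℝ (⊤ : ℕ∞) H :=
    ((χ.contDiff.comp contDiff_fst).mul (χ.contDiff.comp contDiff_snd)).mul hh
  have hHc : HasCompactSupport H := by
    refine HasCompactSupport.intro
      (χ.hasCompactSupport.isCompact.prod χ.hasCompactSupport.isCompact) ?_
    rintro ⟨u, x⟩ hp
    simp only [Set.mem_prod, not_and_or] at hp
    rcases hp with hp | hp <;> simp [H, image_eq_zero_of_notMem_tsupport hp]
  have hHev : ∀ u x, H (u, -x) = H (u, x) := by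
    intro u x
    simp only [H, hev, χ.neg]
  refine ⟨GW ψ 0 H, GW_smooth hi hm 0 hH hHc hHev, fun u x hu hx => ?_⟩
  have h1 : ∀ z : ℝ, |z| ≤ 1 → χ z = 1 := fun z hz =>
    χ.one_of_mem_closedBall (by simpa using hz)
  have h2 : H (u, |x|) = H (u, x) := by
    rcases abs_choice x with e | e <;> rw [e]
    exact hHev u x
  simp only [GW, sq_nonneg, if_true, Real.sqrt_sq_eq_abs, h2]
  simp [H, h1 u hu, h1 x hx]

lemma whitney_decomp {h : ℝ × ℝ → ℝ} (hh : ContDiff ℝ (⊤ : ℕ∞) h) :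
    ∃ g0 g1 : ℝ × ℝ → ℝ, ContDiff ℝ (⊤ : ℕ∞) g0 ∧ ContDiff ℝ (⊤ : ℕ∞) g1 ∧
      g0 (0, 0) = h (0, 0) ∧ g1 (0, 0) = px h (0, 0) ∧
      ∀ u x, |u| ≤ 1 → |x| ≤ 1 → h (u, x) = g0 (u, x ^ 2) + x * g1 (u, x ^ 2) := by
  have hn : ContDiff ℝ (⊤ : ℕ∞) (fun p : ℝ × ℝ => h (p.1, -p.2)) :=
    hh.comp (by fun_prop)
  have hk := had_smooth hh
  have hkn : ContDiff ℝ (⊤ : ℕ∞) (fun p : ℝ × ℝ => had h (p.1, -p.2)) :=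
    hk.comp (by fun_prop)
  obtain ⟨g0, s0, e0⟩ := whitney_even (h := fun p => (h p + h (p.1, -p.2)) / 2)
    ((hh.add hn).div_const 2) (fun u x => by simp [add_comm])
  obtain ⟨g1, s1, e1⟩ := whitney_even (h := fun p => (had h p + had h (p.1, -p.2)) / 2)
    ((hk.add hkn).div_const 2) (fun u x => by simp [add_comm])
  refine ⟨g0, g1, s0, s1, ?_, ?_, fun u x hu hx => ?_⟩
  · have := e0 0 0 (by simp) (by simp)
    simp at this
    exact this.symm
  · have := e1 0 0 (by simp) (by simp)
    simp [had_zero] at this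
    exact this.symm
  · rw [← e0 u x hu hx, ← e1 u x hu hx]
    have h1 := had_eq hh u x
    have h2 := had_eq hh u (-x)
    simp only
    linarith

lemma tan_scalar {c : ℝ → ℝ} (hc : ContDiff ℝ (⊤ : ℕ∞) c) :
    ∃ D0 D1 : ℝ × ℝ → ℝ, ContDiff ℝ (⊤ : ℕ∞) D0 ∧ ContDiff ℝ (⊤ : ℕ∞) D1 ∧
      D0 (0, 0) = deriv (deriv c) 0 / 2 ∧ D1 (0, 0) = - deriv (deriv (deriv c)) 0 / 3 ∧
      ∀ v s, |v| ≤ 1 → |s| ≤ 1 → c (v - s) + s * deriv c (v - s)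
        = c v - s ^ 2 * D0 (v, s ^ 2) - s ^ 3 * D1 (v, s ^ 2) := by
  have s1 : ContDiff ℝ (⊤ : ℕ∞) (deriv c) := (contDiff_infty_iff_deriv.1 hc).2
  have s2 : ContDiff ℝ (⊤ : ℕ∞) (deriv (deriv c)) := (contDiff_infty_iff_deriv.1 s1).2
  have d0 : ∀ t, HasDerivAt c (deriv c t) t := fun t =>
    ((contDiff_infty_iff_deriv.1 hc).1 t).hasDerivAt
  have d1 : ∀ t, HasDerivAt (deriv c) (deriv (deriv c) t) t := fun t =>
    ((contDiff_infty_iff_deriv.1 s1).1 t).hasDerivAt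
  have d2 : ∀ t, HasDerivAt (deriv (deriv c)) (deriv (deriv (deriv c)) t) t := fun t =>
    ((contDiff_infty_iff_deriv.1 s2).1 t).hasDerivAt
  let H : ℝ × ℝ → ℝ := fun p => deriv (deriv c) (p.1 - p.2)
  have hH : ContDiff ℝ (⊤ : ℕ∞) H := s2.comp (by fun_prop)
  let D := KI (Set.indicator (Set.Icc 0 1) fun l => l ^ 1) H
  have hD : ContDiff ℝ (⊤ : ℕ∞) D := KI_smooth (Adm.unit _ 1) hH
  have hpxH : px H (0, 0) = - deriv (deriv (deriv c)) 0 := by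
    have h1 := px_deriv hH 0 0
    have h2 : HasDerivAt (fun x => H (0, x)) (deriv (deriv (deriv c)) (0 - 0) * (-1)) 0 :=
      (d2 (0 - 0)).comp (0 : ℝ) ((hasDerivAt_id (0 : ℝ)).const_sub 0)
    rw [h1.unique h2]; simp
  have hpx : px D (0, 0) = - deriv (deriv (deriv c)) 0 / 3 := by
    have h1 := (px_deriv hD 0 0).unique (KI_dx (Adm.unit _ 1) hH 0 0)
    have hw : (fun l : ℝ => l * (Set.Icc (0 : ℝ) 1).indicator (fun l => l ^ 1) l)
        = (Set.Icc (0 : ℝ) 1).indicator (fun l => l ^ 2) := by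
      funext l
      by_cases hl : l ∈ Set.Icc (0 : ℝ) 1 <;> simp [hl, pow_two]
    rw [h1, hw, KI_unit]
    simp only [mul_zero, hpxH, intervalIntegral.integral_mul_const, integral_pow]
    norm_num
    ring
  have hD00 : D (0, 0) = deriv (deriv c) 0 / 2 := by
    simp only [D]
    rw [KI_unit]
    simp only [mul_zero, H, intervalIntegral.integral_mul_const, integral_pow]
    norm_num
    ring
  have htay : ∀ v s, c (v - s) + s * deriv c (v - s) = c v - s ^ 2 * D (v, s) := by
    intro v s
    simp only [D]
    rw [KI_unit]
    have h1 : ∀ l ∈ Set.uIcc (0 : ℝ) 1,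
        HasDerivAt (fun l => - (s * l) * deriv c (v - l * s) - c (v - l * s))
          (s ^ 2 * (l ^ 1 * H (v, l * s))) l := by
      intro l _
      have hin : HasDerivAt (fun l : ℝ => v - l * s) (-(1 * s)) l :=
        ((hasDerivAt_id l).mul_const s).const_sub v
      have e1 := (d1 (v - l * s)).comp l hin
      have e0 := (d0 (v - l * s)).comp l hin
      have el : HasDerivAt (fun l : ℝ => -(s * l)) (-(s * 1)) l :=
        ((hasDerivAt_id l).const_mul s).neg
      refine ((el.mul e1).sub e0).congr_deriv ?_
      simp only [H, Function.comp]
      ring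
    have hcont := hH.continuous
    have h2 := intervalIntegral.integral_eq_sub_of_hasDerivAt h1
      (by apply Continuous.intervalIntegrable; fun_prop)
    rw [intervalIntegral.integral_const_mul] at h2
    simp only [one_mul, zero_mul, mul_one, mul_zero, sub_zero, neg_zero] at h2
    simp only
    linarith
  obtain ⟨g0, g1, k0, k1, z0, z1, e⟩ := whitney_decomp hD
  refine ⟨g0, g1, k0, k1, z0.trans hD00, z1.trans hpx, fun v s hv hs => ?_⟩
  rw [htay, e v s hv hs]
  ring

lemma deriv_comp_apply {γ : ℝ → Fin 3 → ℝ} (hγ : ContDiff ℝ (⊤ : ℕ∞) γ) (i : Fin 3) :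
    (fun t => deriv γ t i) = deriv (fun t => γ t i) := by
  funext t
  have h := hasDerivAt_pi.1 (((contDiff_infty_iff_deriv.1 hγ).1 t).hasDerivAt) i
  exact h.deriv.symm

lemma fderiv_aux {c : ℝ → ℝ} {D0 D1 : ℝ × ℝ → ℝ} {a : ℝ} (hc : HasDerivAt c a 0)
    (h0 : ContDiff ℝ (⊤ : ℕ∞) D0) (h1 : ContDiff ℝ (⊤ : ℕ∞) D1) :
    HasFDerivAt (fun w : Fin 3 → ℝ => c (w 0) - w 1 * D0 (w 0, w 1) - w 2 * D1 (w 0, w 1))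
      (a • ContinuousLinearMap.proj (R := ℝ) (φ := fun _ : Fin 3 => ℝ) 0
        - D0 (0, 0) • ContinuousLinearMap.proj (R := ℝ) (φ := fun _ : Fin 3 => ℝ) 1
        - D1 (0, 0) • ContinuousLinearMap.proj (R := ℝ) (φ := fun _ : Fin 3 => ℝ) 2) 0 := by
  have p : ∀ i : Fin 3, HasFDerivAt (fun w : Fin 3 → ℝ => w i)
      (ContinuousLinearMap.proj (R := ℝ) (φ := fun _ : Fin 3 => ℝ) i) 0 :=
    fun i => hasFDerivAt_apply i 0
  have hA : HasFDerivAt (fun w : Fin 3 → ℝ => c (w 0)) _ 0 :=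
    HasDerivAt.comp_hasFDerivAt (h₂ := c) (0 : Fin 3 → ℝ) hc (p 0)
  have q : ∀ D : ℝ × ℝ → ℝ, ContDiff ℝ (⊤ : ℕ∞) D →
      DifferentiableAt ℝ (fun w : Fin 3 → ℝ => D (w 0, w 1)) 0 := by
    intro D hD
    have : ContDiff ℝ (⊤ : ℕ∞) (fun w : Fin 3 → ℝ => D (w 0, w 1)) := hD.comp (by fun_prop)
    exact this.differentiable (by simp) 0
  have hB := (p 1).mul (q D0 h0).hasFDerivAt
  have hC := (p 2).mul (q D1 h1).hasFDerivAt
  refine ((hA.sub hB).sub hC).congr_fderiv ?_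
  ext w
  simp

end CuspidalEdgeAux

/-- The tangent variety to a curve `γ` of type `(1,2,3)` at `0` is locally diffeomorphic
to the cuspidal edge `(u, x) ↦ (u, x², x³)`. -/
theorem tangent_variety_type_123_cuspidal_edge
    (γ : ℝ → Fin 3 → ℝ) (hγ : ContDiff ℝ (⊤ : ℕ∞) γ)
    (htype : LinearIndependent ℝ
      ![iteratedDeriv 1 γ 0, iteratedDeriv 2 γ 0, iteratedDeriv 3 γ 0]) :
    GermEquiv (fun p : ℝ × ℝ => γ p.2 + p.1 • deriv γ p.2) (0 : ℝ × ℝ)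
      (fun p : ℝ × ℝ => ![p.1, p.2 ^ 2, p.2 ^ 3]) (0 : ℝ × ℝ) := by
  have s1 : ContDiff ℝ (⊤ : ℕ∞) (deriv γ) := (contDiff_infty_iff_deriv.1 hγ).2
  have s2 : ContDiff ℝ (⊤ : ℕ∞) (deriv (deriv γ)) := (contDiff_infty_iff_deriv.1 s1).2
  have hci : ∀ i, ContDiff ℝ (⊤ : ℕ∞) (fun t => γ t i) := fun i => contDiff_pi.1 hγ i
  choose D0 D1 k0 k1 z0 z1 hD using fun i => tan_scalar (hci i)
  have e1 : ∀ i t, deriv (fun t => γ t i) t = deriv γ t i := fun i t =>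
    (congrFun (deriv_comp_apply hγ i) t).symm
  have e2 : ∀ i, deriv (deriv (fun t => γ t i)) 0 = deriv (deriv γ) 0 i := fun i => by
    rw [← deriv_comp_apply hγ i, ← deriv_comp_apply s1 i]
  have e3 : ∀ i, deriv (deriv (deriv (fun t => γ t i))) 0 = deriv (deriv (deriv γ)) 0 i :=
    fun i => by
      rw [← deriv_comp_apply hγ i, ← deriv_comp_apply s1 i, ← deriv_comp_apply s2 i]
  let Ψ : (Fin 3 → ℝ) → Fin 3 → ℝ := fun w i =>
    γ (w 0) i - w 1 * D0 i (w 0, w 1) - w 2 * D1 i (w 0, w 1)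
  have hΨ : ContDiff ℝ (⊤ : ℕ∞) Ψ := by
    rw [contDiff_pi]
    intro i
    have q : ∀ D : ℝ × ℝ → ℝ, ContDiff ℝ (⊤ : ℕ∞) D →
        ContDiff ℝ (⊤ : ℕ∞) (fun w : Fin 3 → ℝ => D (w 0, w 1)) :=
      fun D h => h.comp (by fun_prop)
    have q0 : ContDiff ℝ (⊤ : ℕ∞) (fun w : Fin 3 → ℝ => γ (w 0) i) :=
      (hci i).comp (by fun_prop : ContDiff ℝ (⊤ : ℕ∞) fun w : Fin 3 → ℝ => w 0)
    have p : ∀ j : Fin 3, ContDiff ℝ (⊤ : ℕ∞) (fun w : Fin 3 → ℝ => w j) :=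
      fun j => by fun_prop
    exact (q0.sub ((p 1).mul (q _ (k0 i)))).sub ((p 2).mul (q _ (k1 i)))
  let M : (Fin 3 → ℝ) →ₗ[ℝ] (Fin 3 → ℝ) :=
    (LinearMap.proj (R := ℝ) (φ := fun _ : Fin 3 => ℝ) 0).smulRight (deriv γ 0)
    + (LinearMap.proj (R := ℝ) (φ := fun _ : Fin 3 => ℝ) 1).smulRight
        ((-1 / 2 : ℝ) • deriv (deriv γ) 0)
    + (LinearMap.proj (R := ℝ) (φ := fun _ : Fin 3 => ℝ) 2).smulRight
        ((1 / 3 : ℝ) • deriv (deriv (deriv γ)) 0)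
  have hM : Function.Injective M := by
    rw [← LinearMap.ker_eq_bot, LinearMap.ker_eq_bot']
    intro w hw
    rw [Fintype.linearIndependent_iff] at htype
    have h := htype ![w 0, w 1 * (-1 / 2), w 2 * (1 / 3)] (by
      simp only [Fin.sum_univ_three, iteratedDeriv_succ, iteratedDeriv_zero]
      rw [← hw]
      simp [M, smul_smul])
    have h0 := h 0
    have h1 := h 1
    have h2 := h 2
    simp at h0 h1 h2
    funext i
    fin_cases i <;> simp [h0, h1, h2]
  let e : (Fin 3 → ℝ) ≃L[ℝ] (Fin 3 → ℝ) :=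
    (LinearEquiv.ofInjectiveEndo M hM).toContinuousLinearEquiv
  have he : ∀ w, e w = M w := fun w => rfl
  have hfd : HasFDerivAt Ψ (e : (Fin 3 → ℝ) →L[ℝ] (Fin 3 → ℝ)) 0 := by
    rw [hasFDerivAt_pi']
    intro i
    have hc1 : HasDerivAt (fun t => γ t i) (deriv γ 0 i) 0 := by
      rw [← e1 i 0]
      exact ((contDiff_infty_iff_deriv.1 (hci i)).1 0).hasDerivAt
    refine (fderiv_aux hc1 (k0 i) (k1 i)).congr_fderiv ?_
    ext1 w
    simp only [ContinuousLinearMap.comp_apply, ContinuousLinearEquiv.coe_coe, he]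
    simp [M, z0, z1, e2, e3]
    ring
  have hΨ0 : Ψ 0 = γ 0 := by funext i; simp [Ψ]
  have hn : (((⊤ : ℕ∞) : WithTop ℕ∞)) ≠ 0 := by simp
  let τ := hΨ.contDiffAt.localInverse hfd hn
  have hst := (hΨ.contDiffAt (x := 0)).hasStrictFDerivAt' hfd hn
  have hτ : ContDiffAt ℝ (⊤ : ℕ∞) τ (Ψ 0) := hΨ.contDiffAt.to_localInverse hfd hn
  have hτ0 : τ (Ψ 0) = 0 := hΨ.contDiffAt.localInverse_apply_image hfd hn
  have hl : ∀ᶠ w in 𝓝 (0 : Fin 3 → ℝ), τ (Ψ w) = w := hst.eventually_left_inverse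
  have hr : ∀ᶠ z in 𝓝 (Ψ 0), Ψ (τ z) = z := hst.eventually_right_inverse
  have hf0 : (fun p : ℝ × ℝ => γ p.2 + p.1 • deriv γ p.2) 0 = Ψ 0 := by
    rw [hΨ0]; simp
  have hg0 : (fun p : ℝ × ℝ => ![p.1, p.2 ^ 2, p.2 ^ 3]) 0 = 0 := by
    funext i; fin_cases i <;> simp
  refine ⟨fun p => (p.2 + p.1, p.1), fun q => (q.2, q.1 - q.2), τ, Ψ, by simp, ?_, ?_, ?_, ?_,
    hΨ.contDiffAt, ?_, ?_, ?_, ?_, ?_⟩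
  · rw [hf0, hg0, hτ0]
  · fun_prop
  · fun_prop
  · rw [hf0]; exact hτ
  · exact Eventually.of_forall fun x => by simp
  · exact Eventually.of_forall fun x => by simp
  · rw [hf0]; exact hr
  · rw [hg0]; exact hl
  · have hcont : Tendsto (fun p : ℝ × ℝ => ![p.2 + p.1, p.1 ^ 2, p.1 ^ 3]) (𝓝 0)
        (𝓝 (0 : Fin 3 → ℝ)) := by
      have hc : Continuous (fun p : ℝ × ℝ => ![p.2 + p.1, p.1 ^ 2, p.1 ^ 3]) := by
        refine continuous_pi fun i => ?_
        fin_cases i <;> simp <;> fun_prop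
      have := hc.tendsto 0
      convert this using 2
      funext i; fin_cases i <;> simp
    have b1 : ∀ᶠ p : ℝ × ℝ in 𝓝 0, |p.2 + p.1| < 1 :=
      ContinuousAt.eventually_lt (by fun_prop) continuousAt_const (by simp)
    have b2 : ∀ᶠ p : ℝ × ℝ in 𝓝 0, |p.1| < 1 :=
      ContinuousAt.eventually_lt (by fun_prop) continuousAt_const (by simp)
    filter_upwards [hcont.eventually hl, b1, b2] with p hp hb1 hb2
    have hfe : γ p.2 + p.1 • deriv γ p.2 = Ψ ![p.2 + p.1, p.1 ^ 2, p.1 ^ 3] := by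
      funext i
      have := hD i (p.2 + p.1) p.1 hb1.le hb2.le
      rw [add_sub_cancel_right, e1] at this
      simpa [Ψ] using this
    rw [hfe, hp]
end

section
/- Let γ : ℝ → ℝ³ be a C^∞ curve such that γ'(0) and γ''(0) are linearly independent, γ'''(0) ∈ span{γ'(0), γ''(0)}, and γ''''(0) ∉ span{γ'(0), γ''(0)} (i.e. γ has type (1,2,4) at 0). Then the tangent map-germ Tan(γ)(s,t) = γ(t) + s·γ'(t) at (0,0) is diffeomorphic (right–left equivalent) to the folded umbrella map-germ (u,x) ↦ (u, x² + ux, (1/2)x⁴ + (1/3)ux³) at 0. -/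
open Filter Topology

open MeasureTheory

section PI
variable {Ω E : Type} [NormedAddCommGroup Ω] [NormedSpace ℝ Ω] [MeasurableSpace Ω]
  [OpensMeasurableSpace Ω] [SecondCountableTopology Ω]
  [NormedAddCommGroup E] [NormedSpace ℝ E] [FiniteDimensional ℝ E]

theorem pi_step {G : Type} [NormedAddCommGroup G] [NormedSpace ℝ G]
    {μ : Measure Ω} {F : Ω → E → G}
    (hF : ContDiff ℝ (⊤ : ℕ∞) (fun q : Ω × E => F q.1 q.2)) (x₀ : E) {U : Set E} (hU : U ∈ 𝓝 x₀)
    {b0 b1 : Ω → ℝ} (h0 : Integrable b0 μ) (h1 : Integrable b1 μ)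
    (hb0 : ∀ᵐ ω ∂μ, ∀ x ∈ U, ‖F ω x‖ ≤ b0 ω)
    (hb1 : ∀ᵐ ω ∂μ, ∀ x ∈ U, ‖fderiv ℝ (F ω) x‖ ≤ b1 ω) :
    HasFDerivAt (fun x => ∫ ω, F ω x ∂μ) (∫ ω, fderiv ℝ (F ω) x₀ ∂μ) x₀ := by
  have hsec : ∀ x, Continuous fun ω => F ω x := fun x =>
    hF.continuous.comp (by fun_prop : Continuous fun ω : Ω => (ω, x))
  have hd : ContDiff ℝ (⊤ : ℕ∞) (fun q : Ω × E => fderiv ℝ (F q.1) q.2) := by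
    refine ContDiff.fderiv (m := (⊤ : ℕ∞)) (n := (⊤ : ℕ∞)) (f := fun q : Ω × E => F q.1) (g := fun q => q.2) ?_ contDiff_snd (by simp)
    exact hF.comp (by fun_prop : ContDiff ℝ (⊤ : ℕ∞) fun q : (Ω × E) × E => (q.1.1, q.2))
  have hdsec : Continuous fun ω => fderiv ℝ (F ω) x₀ :=
    hd.continuous.comp (by fun_prop : Continuous fun ω : Ω => (ω, x₀))
  have hx₀ : x₀ ∈ U := mem_of_mem_nhds hU
  refine hasFDerivAt_integral_of_dominated_of_fderiv_le (F := fun x ω => F ω x)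
    (F' := fun x ω => fderiv ℝ (F ω) x) (bound := b1) hU ?_ ?_ ?_ hb1 h1 ?_
  · exact Eventually.of_forall fun x => (hsec x).aestronglyMeasurable
  · refine h0.mono' (hsec x₀).aestronglyMeasurable ?_
    filter_upwards [hb0] with ω h using h _ hx₀
  · exact hdsec.aestronglyMeasurable
  · refine Eventually.of_forall fun ω x _ => ?_
    have : ContDiff ℝ (⊤ : ℕ∞) (F ω) :=
      hF.comp (by fun_prop : ContDiff ℝ (⊤ : ℕ∞) fun x : E => (ω, x))
    exact (this.differentiable (by simp)).differentiableAt.hasFDerivAt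

theorem pi_smooth_fderiv {G : Type} [NormedAddCommGroup G] [NormedSpace ℝ G] {F : Ω → E → G}
    (hF : ContDiff ℝ (⊤ : ℕ∞) (fun q : Ω × E => F q.1 q.2)) :
    ContDiff ℝ (⊤ : ℕ∞) (fun q : Ω × E => fderiv ℝ (F q.1) q.2) := by
  refine ContDiff.fderiv (m := (⊤ : ℕ∞)) (n := (⊤ : ℕ∞)) (f := fun q : Ω × E => F q.1) (g := fun q => q.2) ?_ contDiff_snd (by simp)
  exact hF.comp (by fun_prop : ContDiff ℝ (⊤ : ℕ∞) fun q : (Ω × E) × E => (q.1.1, q.2))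

/-- smoothness of parametric integrals with globally dominated derivatives -/
theorem pi_dominated {μ : Measure Ω} (n : ℕ) : ∀ {G : Type} [NormedAddCommGroup G] [NormedSpace ℝ G]
    {F : Ω → E → G}
    (_ : ContDiff ℝ (⊤ : ℕ∞) (fun q : Ω × E => F q.1 q.2))
    (_ : ∀ k : ℕ, ∃ b : Ω → ℝ, Integrable b μ ∧ ∀ ω x, ‖iteratedFDeriv ℝ k (F ω) x‖ ≤ b ω),
    ContDiff ℝ n (fun x => ∫ ω, F ω x ∂μ) := by
  induction n with
  | zero =>
    intro G _ _ F hF hb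
    obtain ⟨b0, h0, hb0⟩ := hb 0
    obtain ⟨b1, h1, hb1⟩ := hb 1
    refine contDiff_zero.2 (continuous_iff_continuousAt.2 fun x => ?_)
    refine (pi_step hF x univ_mem h0 h1 (Eventually.of_forall fun ω x _ => ?_)
      (Eventually.of_forall fun ω x _ => ?_)).continuousAt
    · simpa using hb0 ω x
    · simpa using hb1 ω x
  | succ n ih =>
    intro G _ _ F hF hb
    obtain ⟨b0, h0, hb0⟩ := hb 0
    obtain ⟨b1, h1, hb1⟩ := hb 1
    refine (contDiff_succ_iff_hasFDerivAt (n := n)).2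
      ⟨fun x => ∫ ω, fderiv ℝ (F ω) x ∂μ, ih (pi_smooth_fderiv hF) ?_, fun x => ?_⟩
    · intro k
      obtain ⟨b, h, hb⟩ := hb (k+1)
      exact ⟨b, h, fun ω x => by
        have := hb ω x
        rwa [← norm_iteratedFDeriv_fderiv] at this⟩
    · refine (pi_step hF x univ_mem h0 h1 (Eventually.of_forall fun ω x _ => ?_)
        (Eventually.of_forall fun ω x _ => ?_))
      · simpa using hb0 ω x
      · simpa using hb1 ω x

theorem pi_compact_step {K : Set Ω} (hK : IsCompact K) (hKm : MeasurableSet K)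
    {μ : Measure Ω} [IsFiniteMeasure (μ.restrict K)] {G : Type} [NormedAddCommGroup G] [NormedSpace ℝ G]
    {F : Ω → E → G}
    (hF : ContDiff ℝ (⊤ : ℕ∞) (fun q : Ω × E => F q.1 q.2)) (x : E) :
    HasFDerivAt (fun x => ∫ ω in K, F ω x ∂μ) (∫ ω in K, fderiv ℝ (F ω) x ∂μ) x := by
  have hKB := hK.prod (isCompact_closedBall x 1)
  obtain ⟨b0, hb0⟩ := hKB.exists_bound_of_continuousOn hF.continuous.continuousOn
  obtain ⟨b1, hb1⟩ := hKB.exists_bound_of_continuousOn (pi_smooth_fderiv hF).continuous.continuousOn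
  refine pi_step hF x (Metric.closedBall_mem_nhds x one_pos) (b0 := fun _ => b0) (b1 := fun _ => b1)
    (integrable_const _) (integrable_const _) ?_ ?_
  · filter_upwards [ae_restrict_mem hKm] with ω hω y hy using hb0 (ω, y) ⟨hω, hy⟩
  · filter_upwards [ae_restrict_mem hKm] with ω hω y hy using hb1 (ω, y) ⟨hω, hy⟩

theorem pi_compact {K : Set Ω} (hK : IsCompact K) (hKm : MeasurableSet K)
    {μ : Measure Ω} [IsFiniteMeasure (μ.restrict K)] (n : ℕ) :
    ∀ {G : Type} [NormedAddCommGroup G] [NormedSpace ℝ G]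
    {F : Ω → E → G}
    (_ : ContDiff ℝ (⊤ : ℕ∞) (fun q : Ω × E => F q.1 q.2)),
    ContDiff ℝ n (fun x => ∫ ω in K, F ω x ∂μ) := by
  induction n with
  | zero =>
    intro G _ _ F hF
    exact contDiff_zero.2 (continuous_iff_continuousAt.2 fun x =>
      (pi_compact_step hK hKm hF x).continuousAt)
  | succ n ih =>
    intro G _ _ F hF
    exact (contDiff_succ_iff_hasFDerivAt (n := n)).2
      ⟨fun x => ∫ ω in K, fderiv ℝ (F ω) x ∂μ, ih (pi_smooth_fderiv hF),
        fun x => pi_compact_step hK hKm hF x⟩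
end PI

/-- cutoff -/
theorem cutoff_extend {E : Type} [NormedAddCommGroup E] [NormedSpace ℝ E] [FiniteDimensional ℝ E]
    {f : E → ℝ} {a : E} (hf : ∀ᶠ x in 𝓝 a, ContDiffAt ℝ (⊤ : ℕ∞) f x) :
    ∃ g : E → ℝ, ContDiff ℝ (⊤ : ℕ∞) g ∧ HasCompactSupport g ∧ g =ᶠ[𝓝 a] f := by
  obtain ⟨r, hr, hball⟩ := Metric.eventually_nhds_iff_ball.1 hf
  let φ : ContDiffBump a := ⟨r/4, r/2, by positivity, by linarith⟩
  refine ⟨fun x => φ x * f x, ?_, φ.hasCompactSupport.mul_right, ?_⟩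
  · rw [contDiff_iff_contDiffAt]
    intro x
    by_cases hx : x ∈ Metric.ball a r
    · exact φ.contDiff.contDiffAt.mul (hball x hx)
    · have : (fun x => φ x * f x) =ᶠ[𝓝 x] fun _ => 0 := by
        have h1 : x ∉ tsupport φ := by
          rw [φ.tsupport_eq]
          simp only [Metric.mem_ball, Metric.mem_closedBall, not_lt, not_le] at hx ⊢
          change r/2 < _
          linarith
        have h2 := notMem_tsupport_iff_eventuallyEq.1 h1
        filter_upwards [h2] with y hy
        simp [hy]
      exact contDiffAt_const.congr_of_eventuallyEq this
  · filter_upwards [φ.eventuallyEq_one] with x hx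
    simp [hx]

/-- The entire function `cos √z`. -/
theorem exists_cosSqrt : ∃ C : ℝ → ℝ, ContDiff ℝ (⊤ : ℕ∞) C ∧ ∀ x, C (x ^ 2) = Real.cos x := by
  let c : ℕ → ℝ := fun n => (-1) ^ n / (2 * n).factorial
  have hrad : (FormalMultilinearSeries.ofScalars ℝ c).radius = ⊤ := by
    apply FormalMultilinearSeries.ofScalars_radius_eq_top_of_tendsto
    · exact Eventually.of_forall fun n => by simp [c, Nat.factorial_ne_zero]
    · have : ∀ n : ℕ, ‖c n.succ‖ / ‖c n‖ = 1 / ((2 * n + 2) * (2 * n + 1)) := by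
        intro n
        simp only [c, norm_div, norm_pow, norm_neg, norm_one, one_pow, Nat.succ_eq_add_one]
        rw [show 2 * (n + 1) = 2 * n + 1 + 1 by ring, Nat.factorial_succ, Nat.factorial_succ]
        have : ((2 * n).factorial : ℝ) ≠ 0 := by exact_mod_cast Nat.factorial_ne_zero _
        push_cast
        simp only [norm_mul, Real.norm_eq_abs, Nat.abs_cast]
        rw [abs_of_nonneg (by positivity), abs_of_nonneg (by positivity)]
        field_simp
        ring
      simp_rw [this]
      refine squeeze_zero (fun n => by positivity) (fun n => ?_) tendsto_one_div_add_atTop_nhds_zero_nat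
      apply one_div_le_one_div_of_le (by positivity)
      have : (0 : ℝ) ≤ n := by positivity
      nlinarith
  have hp : HasFPowerSeriesOnBall (FormalMultilinearSeries.ofScalars ℝ c).sum
      (FormalMultilinearSeries.ofScalars ℝ c) 0 ⊤ := by
    rw [← hrad]
    exact FormalMultilinearSeries.hasFPowerSeriesOnBall _ (by rw [hrad]; exact ENNReal.coe_lt_top)
  refine ⟨(FormalMultilinearSeries.ofScalars ℝ c).sum, ?_, fun x => ?_⟩
  · rw [contDiff_iff_contDiffAt]
    intro x
    exact (hp.analyticAt_of_mem (by simp)).contDiffAt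
  · have := FormalMultilinearSeries.ofScalars_sum_eq (E := ℝ) c (x ^ 2)
    change (FormalMultilinearSeries.ofScalars ℝ c).sum (x^2) = _ at this
    rw [this, ← (Real.hasSum_cos x).tsum_eq]
    congr 1
    ext n
    simp only [c, smul_eq_mul, ← pow_mul]
    ring

theorem cosSqrt_sin {C : ℝ → ℝ} (hC : ContDiff ℝ (⊤ : ℕ∞) C) (h : ∀ x, C (x ^ 2) = Real.cos x)
    (x : ℝ) : 2 * x * deriv C (x ^ 2) = - Real.sin x := by
  have h1 : HasDerivAt (fun x => C (x ^ 2)) (deriv C (x ^ 2) * (2 * x)) x := by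
    have := (hC.differentiable (by simp) (x ^ 2)).hasDerivAt.comp x (hasDerivAt_pow 2 x)
    exact this.congr_deriv (by simp)
  have h2 : HasDerivAt (fun x => C (x ^ 2)) (- Real.sin x) x := by
    simp_rw [h]; exact Real.hasDerivAt_cos x
  rw [← h1.unique h2]; ring

theorem hasDerivAt_iteratedDeriv' {f : ℝ → ℝ} (hf : ContDiff ℝ (⊤ : ℕ∞) f) (n : ℕ) (x : ℝ) :
    HasDerivAt (iteratedDeriv n f) (iteratedDeriv (n + 1) f x) x := by
  rw [iteratedDeriv_succ]
  have := hf.differentiable_iteratedDeriv n (by exact_mod_cast ENat.natCast_lt_top n)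
  exact (this x).hasDerivAt

theorem cosSqrt_ode {C : ℝ → ℝ} (hC : ContDiff ℝ (⊤ : ℕ∞) C) (h : ∀ x, C (x ^ 2) = Real.cos x)
    (n : ℕ) : ∀ z > 0, 4 * z * iteratedDeriv (n + 2) C z + (4 * n + 2) * iteratedDeriv (n + 1) C z
      + iteratedDeriv n C z = 0 := by
  induction n with
  | zero =>
    intro z hz
    obtain ⟨x, hx, rfl⟩ : ∃ x : ℝ, 0 < x ∧ x ^ 2 = z := ⟨√z, Real.sqrt_pos.2 hz, Real.sq_sqrt hz.le⟩
    have h1 : HasDerivAt (fun x => 2 * x * deriv C (x ^ 2))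
        (2 * deriv C (x ^ 2) + 2 * x * (iteratedDeriv 2 C (x ^ 2) * (2 * x))) x := by
      have h3 := (hasDerivAt_iteratedDeriv' hC 1 (x ^ 2)).comp x (hasDerivAt_pow 2 x)
      have h4 := ((hasDerivAt_id x).const_mul 2).mul h3
      simp only [iteratedDeriv_one] at h4
      exact h4.congr_deriv (by simp)
    have h2 : HasDerivAt (fun x => 2 * x * deriv C (x ^ 2)) (- Real.cos x) x := by
      simp_rw [cosSqrt_sin hC h]; exact (Real.hasDerivAt_sin x).neg
    have := h1.unique h2
    rw [← h x] at this
    simp only [iteratedDeriv_one, iteratedDeriv_zero, zero_add]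
    push_cast
    linear_combination this
  | succ n ih =>
    intro z hz
    have h1 : HasDerivAt (fun z => 4 * z * iteratedDeriv (n + 2) C z + (4 * n + 2) * iteratedDeriv (n + 1) C z
      + iteratedDeriv n C z) (4 * iteratedDeriv (n + 2) C z + 4 * z * iteratedDeriv (n + 3) C z
        + (4 * n + 2) * iteratedDeriv (n + 2) C z + iteratedDeriv (n + 1) C z) z := by
      have := (((((hasDerivAt_id z).const_mul 4).mul (hasDerivAt_iteratedDeriv' hC (n+2) z))).add
        ((hasDerivAt_iteratedDeriv' hC (n+1) z).const_mul (4 * (n:ℝ) + 2))).add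
        (hasDerivAt_iteratedDeriv' hC n z)
      exact this.congr_deriv (by simp)
    have h2 : HasDerivAt (fun z => 4 * z * iteratedDeriv (n + 2) C z + (4 * n + 2) * iteratedDeriv (n + 1) C z
      + iteratedDeriv n C z) 0 z := by
      refine (hasDerivAt_const z (0:ℝ)).congr_of_eventuallyEq ?_
      filter_upwards [lt_mem_nhds hz] with y hy using ih y hy
    have := h1.unique h2
    push_cast
    rw [show n + 1 + 2 = n + 3 by ring, show n + 1 + 1 = n + 2 by ring]
    linear_combination this

theorem cosSqrt_bound {C : ℝ → ℝ} (hC : ContDiff ℝ (⊤ : ℕ∞) C) (h : ∀ x, C (x ^ 2) = Real.cos x)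
    (n : ℕ) : ∀ z ≥ 0, |iteratedDeriv n C z| ≤ |iteratedDeriv n C 0| := by
  let E : ℝ → ℝ := fun z => 4 * z * iteratedDeriv (n + 1) C z ^ 2 + iteratedDeriv n C z ^ 2
  have hd : ∀ z, HasDerivAt E (4 * iteratedDeriv (n+1) C z ^ 2 + 4 * z * (2 * iteratedDeriv (n+1) C z * iteratedDeriv (n+2) C z) + 2 * iteratedDeriv n C z * iteratedDeriv (n+1) C z) z := by
    intro z
    have := (((hasDerivAt_id z).const_mul 4).mul ((hasDerivAt_iteratedDeriv' hC (n+1) z).pow 2)).add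
      ((hasDerivAt_iteratedDeriv' hC n z).pow 2)
    exact this.congr_deriv (by simp)
  have hanti : AntitoneOn E (Set.Ici 0) := by
    apply antitoneOn_of_deriv_nonpos (convex_Ici 0)
    · exact fun z _ => (hd z).continuousAt.continuousWithinAt
    · exact fun z _ => (hd z).differentiableAt.differentiableWithinAt
    · intro z hz
      rw [interior_Ici] at hz
      rw [(hd z).deriv]
      have := cosSqrt_ode hC h n z hz
      have h2 : 4 * iteratedDeriv (n+1) C z ^ 2 + 4 * z * (2 * iteratedDeriv (n+1) C z * iteratedDeriv (n+2) C z) + 2 * iteratedDeriv n C z * iteratedDeriv (n+1) C z = - (8 * n * iteratedDeriv (n+1) C z ^ 2) := by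
        linear_combination 2 * iteratedDeriv (n+1) C z * this
      rw [h2]
      have : 0 ≤ 8 * n * iteratedDeriv (n+1) C z ^ 2 := by positivity
      linarith
  intro z hz
  have h1 := hanti (Set.mem_Ici.2 le_rfl) (Set.mem_Ici.2 hz) hz
  apply sq_le_sq.1
  have h3 : 0 ≤ 4 * z * iteratedDeriv (n + 1) C z ^ 2 := by positivity
  simp only [E] at h1
  linarith

theorem exists_bounded_ext {D : ℝ → ℝ} (hD : ContDiff ℝ (⊤ : ℕ∞) D)
    (hb : ∀ n, ∃ M, ∀ z ≥ 0, |iteratedDeriv n D z| ≤ M) :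
    ∃ k : ℝ → ℝ, ContDiff ℝ (⊤ : ℕ∞) k ∧ (∀ z ≥ 0, k z = D z) ∧
      ∀ n, ∃ M, ∀ z, |iteratedDeriv n k z| ≤ M := by
  let k : ℝ → ℝ := fun z => D z * Real.smoothTransition (z + 1)
  have hk : ContDiff ℝ (⊤ : ℕ∞) k :=
    hD.mul (Real.smoothTransition.contDiff.comp (contDiff_id.add contDiff_const))
  have heq : ∀ z ≥ 0, k z = D z := by
    intro z hz
    simp only [k]
    rw [Real.smoothTransition.one_of_one_le (by linarith), mul_one]
  refine ⟨k, hk, heq, fun n => ?_⟩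
  obtain ⟨M, hM⟩ := hb n
  have hcont : Continuous (iteratedDeriv n k) := hk.continuous_iteratedDeriv n (by exact_mod_cast le_top)
  obtain ⟨M', hM'⟩ := (isCompact_Icc (a := (-1:ℝ)) (b := 0)).exists_bound_of_continuousOn hcont.continuousOn
  refine ⟨max M M', fun z => ?_⟩
  rcases lt_or_ge 0 z with hz | hz
  · have : k =ᶠ[𝓝 z] D := by filter_upwards [lt_mem_nhds hz] with y hy using heq y hy.le
    rw [this.iteratedDeriv_eq n]
    exact (hM z hz.le).trans (le_max_left _ _)
  · rcases le_or_gt (-1) z with hz' | hz'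
    · exact (hM' z ⟨hz', hz⟩).trans (le_max_right _ _)
    · have : k =ᶠ[𝓝 z] fun _ => 0 := by
        filter_upwards [gt_mem_nhds hz'] with y hy
        simp only [k]
        rw [Real.smoothTransition.zero_of_nonpos (by linarith), mul_zero]
      rw [this.iteratedDeriv_eq n]
      have h0 : iteratedDeriv n (fun _ : ℝ => (0:ℝ)) z = 0 := by
        simp
      rw [h0, abs_zero]
      exact (abs_nonneg _).trans ((hM 0 le_rfl).trans (le_max_left _ _))

theorem exists_kernels : ∃ k0 k1 : ℝ → ℝ, ContDiff ℝ (⊤ : ℕ∞) k0 ∧ ContDiff ℝ (⊤ : ℕ∞) k1 ∧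
    (∀ n, ∃ M, ∀ z, |iteratedDeriv n k0 z| ≤ M) ∧ (∀ n, ∃ M, ∀ z, |iteratedDeriv n k1 z| ≤ M) ∧
    (∀ x, k0 (x ^ 2) = Real.cos x) ∧ (∀ x, x * k1 (x ^ 2) = Real.sin x) := by
  obtain ⟨C, hC, h⟩ := exists_cosSqrt
  obtain ⟨k0, h1, h2, h3⟩ := exists_bounded_ext hC fun n => ⟨_, cosSqrt_bound hC h n⟩
  have hC' : ContDiff ℝ (⊤ : ℕ∞) (deriv C) := contDiff_infty_iff_deriv.1 hC |>.2
  have hD : ContDiff ℝ (⊤ : ℕ∞) (fun z => (-2) * deriv C z) := contDiff_const.mul hC'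
  obtain ⟨k1, g1, g2, g3⟩ := exists_bounded_ext hD (fun n => ⟨2 * |iteratedDeriv (n+1) C 0|, fun z hz => by
    rw [iteratedDeriv_const_mul_field, ← iteratedDeriv_succ', abs_mul]
    have := cosSqrt_bound hC h (n+1) z hz
    simpa using this⟩)
  refine ⟨k0, k1, h1, g1, h3, g3, fun x => ?_, fun x => ?_⟩
  · rw [h2 _ (by positivity), h]
  · rw [g2 _ (by positivity)]
    linear_combination - cosSqrt_sin hC h x
theorem norm_iteratedFDeriv_comp_lin {f : ℝ → ℂ} (hf : ContDiff ℝ (⊤ : ℕ∞) f) {n : ℕ} {M : ℝ}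
    (hM : ∀ x, ‖iteratedDeriv n f x‖ ≤ M) (r : ℝ) (L : ℝ × ℝ →L[ℝ] ℝ) (hL : ‖L‖ ≤ 1) (p : ℝ × ℝ) :
    ‖iteratedFDeriv ℝ n (fun p => f (r * L p)) p‖ ≤ M * |r| ^ n := by
  have h := (r • L).iteratedFDeriv_comp_right hf p (i := n) (by exact_mod_cast le_top)
  have h2 : (fun p => f (r * L p)) = f ∘ (r • L) := by ext p; simp
  rw [h2, h]
  refine (ContinuousMultilinearMap.norm_compContinuousLinearMap_le _ _).trans ?_
  rw [norm_iteratedFDeriv_eq_norm_iteratedDeriv]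
  simp only [Finset.prod_const, Finset.card_univ, Fintype.card_fin]
  have h3 : ‖r • L‖ ≤ |r| := by
    rw [norm_smul, Real.norm_eq_abs]
    exact mul_le_of_le_one_right (abs_nonneg r) hL
  have h4 : 0 ≤ M := (norm_nonneg _).trans (hM 0)
  exact mul_le_mul (hM _) (pow_le_pow_left₀ (norm_nonneg _) h3 n) (by positivity) h4

theorem cexp_bound (n : ℕ) : ∀ x : ℝ, ‖iteratedDeriv n (fun x : ℝ => Complex.exp (2 * Real.pi * Complex.I * x)) x‖ ≤ (2 * Real.pi) ^ n := by
  have key : ∀ n : ℕ, iteratedDeriv n (fun x : ℝ => Complex.exp (2 * Real.pi * Complex.I * x)) =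
      fun x : ℝ => (2 * Real.pi * Complex.I) ^ n * Complex.exp (2 * Real.pi * Complex.I * x) := by
    intro n
    induction n with
    | zero => ext x; simp
    | succ n ih =>
      rw [iteratedDeriv_succ, ih]
      ext x
      have h1 : HasDerivAt (fun x : ℝ => 2 * Real.pi * Complex.I * (x : ℂ)) (2 * Real.pi * Complex.I) x := by
        simpa using (Complex.ofRealCLM.hasDerivAt (x := x)).const_mul (2 * (Real.pi : ℂ) * Complex.I)
      have h2 := (h1.cexp).const_mul ((2 * Real.pi * Complex.I) ^ n)
      rw [h2.deriv]
      ring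
  intro x
  rw [key]
  have : Complex.exp (2 * Real.pi * Complex.I * x) = Complex.exp ((2 * Real.pi * x : ℝ) * Complex.I) := by
    congr 1; push_cast; ring
  simp only [norm_mul, norm_pow, this, Complex.norm_exp_ofReal_mul_I]
  simp [abs_of_pos Real.pi_pos]

theorem iteratedDeriv_ofReal {k : ℝ → ℝ} (hk : ContDiff ℝ (⊤ : ℕ∞) k) (n : ℕ) :
    iteratedDeriv n (fun x => (k x : ℂ)) = fun x => ((iteratedDeriv n k x : ℝ) : ℂ) := by
  induction n with
  | zero => simp
  | succ n ih =>
    rw [iteratedDeriv_succ, ih]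
    ext x
    exact ((hasDerivAt_iteratedDeriv' hk n x).ofReal_comp).deriv

theorem whitney_smooth {c : EuclideanSpace ℝ (Fin 2) → ℂ} (hc : ContDiff ℝ (⊤ : ℕ∞) c)
    (hci : ∀ k : ℕ, Integrable (fun ξ => ‖ξ‖ ^ k * ‖c ξ‖)) {k : ℝ → ℝ}
    (hk : ContDiff ℝ (⊤ : ℕ∞) k) (hkb : ∀ n, ∃ M, ∀ z, |iteratedDeriv n k z| ≤ M) :
    ContDiff ℝ (⊤ : ℕ∞) (fun p : ℝ × ℝ => ∫ ξ : EuclideanSpace ℝ (Fin 2),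
      c ξ * (Complex.exp (2 * Real.pi * Complex.I * ((ξ 0 * p.1 : ℝ) : ℂ)) *
        (k ((2 * Real.pi * ξ 1) ^ 2 * p.2) : ℂ))) := by
  have he : ContDiff ℝ (⊤ : ℕ∞) (fun x : ℝ => Complex.exp (2 * Real.pi * Complex.I * x)) :=
    (contDiff_const.mul Complex.ofRealCLM.contDiff).cexp
  have hkc : ContDiff ℝ (⊤ : ℕ∞) (fun x : ℝ => (k x : ℂ)) := Complex.ofRealCLM.contDiff.comp hk
  choose M hM using hkb
  have hMc : ∀ n z, ‖iteratedDeriv n (fun x : ℝ => (k x : ℂ)) z‖ ≤ M n := by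
    intro n z
    rw [iteratedDeriv_ofReal hk]
    simpa using hM n z
  have hM0 : ∀ n, 0 ≤ M n := fun n => (norm_nonneg _).trans (hMc n 0)
  rw [contDiff_infty]
  intro n
  refine pi_dominated (F := fun (ξ : EuclideanSpace ℝ (Fin 2)) (p : ℝ × ℝ) => c ξ * (Complex.exp (2 * Real.pi * Complex.I * ((ξ 0 * p.1 : ℝ) : ℂ)) *
        (k ((2 * Real.pi * ξ 1) ^ 2 * p.2) : ℂ))) n ?_ ?_
  · have h0 : ∀ i : Fin 2, ContDiff ℝ (⊤ : ℕ∞) (fun q : EuclideanSpace ℝ (Fin 2) × (ℝ × ℝ) => q.1 i) := by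
      intro i; fun_prop
    refine (hc.comp contDiff_fst).mul ((he.comp ((h0 0).mul (by fun_prop))).mul (hkc.comp (((contDiff_const.mul (h0 1)).pow 2).mul (by fun_prop))))
  · intro m
    refine ⟨fun ξ => ∑ i ∈ Finset.range (m + 1), ((m.choose i : ℝ) * (2 * Real.pi) ^ i * (M (m - i)) * ((2 * Real.pi) ^ 2) ^ (m - i)) * (‖ξ‖ ^ (i + 2 * (m - i)) * ‖c ξ‖), ?_, ?_⟩
    · exact integrable_finset_sum _ fun i _ => (hci _).const_mul _
    · intro ξ p
      have h1 : ContDiff ℝ (⊤ : ℕ∞) (fun p : ℝ × ℝ => Complex.exp (2 * Real.pi * Complex.I * ((ξ 0 * p.1 : ℝ) : ℂ))) :=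
        he.comp (by fun_prop : ContDiff ℝ (⊤ : ℕ∞) fun p : ℝ × ℝ => ξ 0 * p.1)
      have h2 : ContDiff ℝ (⊤ : ℕ∞) (fun p : ℝ × ℝ => (k ((2 * Real.pi * ξ 1) ^ 2 * p.2) : ℂ)) :=
        hkc.comp (by fun_prop : ContDiff ℝ (⊤ : ℕ∞) fun p : ℝ × ℝ => (2 * Real.pi * ξ 1) ^ 2 * p.2)
      have hsm : iteratedFDeriv ℝ m (fun p : ℝ × ℝ => c ξ * (Complex.exp (2 * Real.pi * Complex.I * ((ξ 0 * p.1 : ℝ) : ℂ)) *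
        (k ((2 * Real.pi * ξ 1) ^ 2 * p.2) : ℂ))) p = c ξ • iteratedFDeriv ℝ m (fun p : ℝ × ℝ => (Complex.exp (2 * Real.pi * Complex.I * ((ξ 0 * p.1 : ℝ) : ℂ)) *
        (k ((2 * Real.pi * ξ 1) ^ 2 * p.2) : ℂ))) p := by
        rw [← iteratedFDeriv_const_smul_apply (((h1.mul h2).of_le (by exact_mod_cast le_top)).contDiffAt)]
        rfl
      rw [hsm, norm_smul]
      have h3 := norm_iteratedFDeriv_mul_le h1 h2 p (n := m) (by exact_mod_cast le_top)
      refine (mul_le_mul_of_nonneg_left h3 (norm_nonneg _)).trans ?_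
      rw [Finset.mul_sum]
      refine Finset.sum_le_sum fun i hi => ?_
      have b1 := norm_iteratedFDeriv_comp_lin he (cexp_bound i) (ξ 0) (ContinuousLinearMap.fst ℝ ℝ ℝ) (ContinuousLinearMap.norm_fst_le ..) p
      have b2 := norm_iteratedFDeriv_comp_lin hkc (hMc (m - i)) ((2 * Real.pi * ξ 1) ^ 2) (ContinuousLinearMap.snd ℝ ℝ ℝ) (ContinuousLinearMap.norm_snd_le ..) p
      simp only [ContinuousLinearMap.coe_fst', ContinuousLinearMap.coe_snd'] at b1 b2
      have n0 : |ξ 0| ≤ ‖ξ‖ := PiLp.norm_apply_le ξ 0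
      have n1 : |ξ 1| ≤ ‖ξ‖ := PiLp.norm_apply_le ξ 1
      have c1 : (2 * Real.pi) ^ i * |ξ 0| ^ i ≤ (2 * Real.pi) ^ i * ‖ξ‖ ^ i := by gcongr
      have c2 : M (m - i) * |(2 * Real.pi * ξ 1) ^ 2| ^ (m - i) ≤ M (m - i) * ((2 * Real.pi) ^ 2 * ‖ξ‖ ^ 2) ^ (m - i) := by
        have := hM0 (m - i)
        rw [abs_of_nonneg (by positivity), mul_pow]
        rw [← sq_abs (ξ 1)]
        gcongr
      have hmul := mul_le_mul (b1.trans c1) (b2.trans c2) (norm_nonneg _) (by positivity)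
      calc _ = ‖c ξ‖ * (m.choose i) * (‖iteratedFDeriv ℝ i (fun p : ℝ × ℝ => Complex.exp (2 * Real.pi * Complex.I * ((ξ 0 * p.1 : ℝ) : ℂ))) p‖ * ‖iteratedFDeriv ℝ (m - i) (fun p : ℝ × ℝ => (k ((2 * Real.pi * ξ 1) ^ 2 * p.2) : ℂ)) p‖) := by ring
        _ ≤ ‖c ξ‖ * (m.choose i) * _ := mul_le_mul_of_nonneg_left hmul (by positivity)
        _ = _ := by rw [pow_add, pow_mul, mul_pow]; ring

/-- Whitney's theorem: splitting into even and odd parts, with a parameter. -/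
theorem whitney {g : ℝ × ℝ → ℝ} (hg : ContDiff ℝ (⊤ : ℕ∞) g) (hs : HasCompactSupport g) :
    ∃ A B : ℝ × ℝ → ℝ, ContDiff ℝ (⊤ : ℕ∞) A ∧ ContDiff ℝ (⊤ : ℕ∞) B ∧
      ∀ u w, g (u, w) = A (u, w ^ 2) + w * B (u, w ^ 2) := by
  obtain ⟨k0, k1, hk0, hk1, hb0, hb1, hcos, hsin⟩ := exists_kernels
  let ι : EuclideanSpace ℝ (Fin 2) ≃L[ℝ] ℝ × ℝ :=
    (EuclideanSpace.equiv (Fin 2) ℝ).trans (ContinuousLinearEquiv.finTwoArrow ℝ ℝ)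
  let G : EuclideanSpace ℝ (Fin 2) → ℂ := fun v => (g (ι v) : ℂ)
  have hG : ContDiff ℝ (⊤ : ℕ∞) G := Complex.ofRealCLM.contDiff.comp (hg.comp ι.contDiff)
  have hGs : HasCompactSupport G :=
    (hs.comp_homeomorph ι.toHomeomorph).comp_left (g := fun x : ℝ => (x : ℂ)) (by simp)
  let S : SchwartzMap (EuclideanSpace ℝ (Fin 2)) ℂ := hGs.toSchwartzMap hG
  let T : SchwartzMap (EuclideanSpace ℝ (Fin 2)) ℂ := FourierTransform.fourier S
  have hinv : FourierTransformInv.fourierInv T = S := FourierTransform.fourierInv_fourier_eq S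
  have hTi : ∀ k : ℕ, Integrable (fun ξ => ‖ξ‖ ^ k * ‖T ξ‖) := fun k => T.integrable_pow_mul volume k
  have hTsm : ContDiff ℝ (⊤ : ℕ∞) T := T.smooth _
  let c1 : EuclideanSpace ℝ (Fin 2) → ℂ := fun ξ => T ξ * (Complex.I * ((2 * Real.pi * ξ 1 : ℝ) : ℂ))
  have hc1 : ContDiff ℝ (⊤ : ℕ∞) c1 := by
    refine hTsm.mul (contDiff_const.mul (Complex.ofRealCLM.contDiff.comp ?_))
    exact (by fun_prop : ContDiff ℝ (⊤ : ℕ∞) fun ξ : EuclideanSpace ℝ (Fin 2) => 2 * Real.pi * ξ 1)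
  have hc1i : ∀ k : ℕ, Integrable (fun ξ => ‖ξ‖ ^ k * ‖c1 ξ‖) := by
    intro k
    refine ((hTi (k + 1)).const_mul (2 * Real.pi)).mono' ?_ (Eventually.of_forall fun ξ => ?_)
    · exact ((continuous_norm.pow k).mul hc1.continuous.norm).aestronglyMeasurable
    · have n1 : |ξ 1| ≤ ‖ξ‖ := PiLp.norm_apply_le ξ 1
      rw [Real.norm_of_nonneg (by positivity)]
      simp only [c1, norm_mul, Complex.norm_I, Complex.norm_real, Real.norm_eq_abs, abs_mul, one_mul,
        abs_of_pos Real.pi_pos, abs_two]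
      calc _ = 2 * Real.pi * ‖ξ‖ ^ k * ‖T ξ‖ * |ξ 1| := by ring
        _ ≤ 2 * Real.pi * ‖ξ‖ ^ k * ‖T ξ‖ * ‖ξ‖ := by gcongr
        _ = _ := by ring
  have hA := whitney_smooth hTsm hTi hk0 hb0
  have hB := whitney_smooth hc1 hc1i hk1 hb1
  refine ⟨_, _, Complex.reCLM.contDiff.comp hA, Complex.reCLM.contDiff.comp hB, fun u w => ?_⟩
  have hintg : ∀ {c : EuclideanSpace ℝ (Fin 2) → ℂ} {k : ℝ → ℝ}, ContDiff ℝ (⊤ : ℕ∞) c → (∀ k : ℕ, Integrable (fun ξ => ‖ξ‖ ^ k * ‖c ξ‖)) →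
      ContDiff ℝ (⊤ : ℕ∞) k → (∀ n, ∃ M, ∀ z, |iteratedDeriv n k z| ≤ M) → ∀ u y : ℝ,
      Integrable (fun ξ : EuclideanSpace ℝ (Fin 2) => c ξ * (Complex.exp (2 * Real.pi * Complex.I * ((ξ 0 * u : ℝ) : ℂ)) *
        (k ((2 * Real.pi * ξ 1) ^ 2 * y) : ℂ))) := by
    intro c k hc hci hk hkb u y
    obtain ⟨M, hM⟩ := hkb 0
    refine ((hci 0).const_mul M).mono' ?_ (Eventually.of_forall fun ξ => ?_)
    · have := hc.continuous
      have := hk.continuous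
      exact Continuous.aestronglyMeasurable (by fun_prop)
    · have e1 : Complex.exp (2 * Real.pi * Complex.I * ((ξ 0 * u : ℝ) : ℂ)) = Complex.exp ((2 * Real.pi * (ξ 0 * u) : ℝ) * Complex.I) := by
        congr 1; push_cast; ring
      rw [e1]
      simp only [norm_mul, Complex.norm_exp_ofReal_mul_I, one_mul, Complex.norm_real, Real.norm_eq_abs, pow_zero]
      have := hM ((2 * Real.pi * ξ 1) ^ 2 * y)
      simp only [iteratedDeriv_zero] at this
      rw [mul_comm]
      gcongr
  have h1 : (g (u, w) : ℂ) = S (ι.symm (u, w)) := by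
    change _ = G (ι.symm (u, w))
    simp [G]
  rw [← hinv, SchwartzMap.fourierInv_coe, Real.fourierInv_eq'] at h1
  have h2 : (g (u, w) : ℂ) = (∫ ξ : EuclideanSpace ℝ (Fin 2), T ξ * (Complex.exp (2 * Real.pi * Complex.I * ((ξ 0 * u : ℝ) : ℂ)) *
        (k0 ((2 * Real.pi * ξ 1) ^ 2 * w ^ 2) : ℂ))) + w * ∫ ξ : EuclideanSpace ℝ (Fin 2), c1 ξ * (Complex.exp (2 * Real.pi * Complex.I * ((ξ 0 * u : ℝ) : ℂ)) *
        (k1 ((2 * Real.pi * ξ 1) ^ 2 * w ^ 2) : ℂ)) := by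
    rw [h1, ← integral_const_mul, ← integral_add (hintg hTsm hTi hk0 hb0 u (w ^ 2)) ((hintg hc1 hc1i hk1 hb1 u (w ^ 2)).const_mul _)]
    congr 1
    ext ξ
    have e0 : inner ℝ ξ (ι.symm (u, w)) = ξ 0 * u + ξ 1 * w := by
      simp [ι, PiLp.inner_apply, Fin.sum_univ_two, EuclideanSpace.equiv, mul_comm]
    rw [e0, smul_eq_mul]
    have e1 : ((2 * Real.pi * (ξ 0 * u + ξ 1 * w) : ℝ) : ℂ) * Complex.I = 2 * Real.pi * Complex.I * ((ξ 0 * u : ℝ) : ℂ) + ((2 * Real.pi * ξ 1 * w : ℝ) : ℂ) * Complex.I := by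
      push_cast; ring
    have e2 : (2 * Real.pi * ξ 1) ^ 2 * w ^ 2 = (2 * Real.pi * ξ 1 * w) ^ 2 := by ring
    rw [e1, Complex.exp_add, Complex.exp_mul_I, ← Complex.ofReal_cos, ← Complex.ofReal_sin, e2, hcos, ← hsin]
    simp only [c1]
    push_cast
    ring
  have h3 := congrArg Complex.re h2
  rw [Complex.ofReal_re, Complex.add_re, Complex.re_ofReal_mul] at h3
  exact h3

theorem local_inverse {E : Type} [NormedAddCommGroup E] [NormedSpace ℝ E] [FiniteDimensional ℝ E]
    {σ : E → E} {a : E} (hσ : ContDiffAt ℝ (⊤ : ℕ∞) σ a)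
    (hinj : ∀ v, fderiv ℝ σ a v = 0 → v = 0) :
    ∃ σinv : E → E, σinv (σ a) = a ∧ ContDiffAt ℝ (⊤ : ℕ∞) σinv (σ a) ∧
      (∀ᶠ x in 𝓝 a, σinv (σ x) = x) ∧ (∀ᶠ y in 𝓝 (σ a), σ (σinv y) = y) ∧
      ((∀ᶠ x in 𝓝 a, ContDiffAt ℝ (⊤ : ℕ∞) σ x) →
        ∀ᶠ y in 𝓝 (σ a), ContDiffAt ℝ (⊤ : ℕ∞) σinv y) := by
  have : CompleteSpace E := FiniteDimensional.complete ℝ E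
  have hinj' : Function.Injective (fderiv ℝ σ a : E →ₗ[ℝ] E) :=
    (injective_iff_map_eq_zero _).2 hinj
  let e : E ≃L[ℝ] E := (LinearEquiv.ofInjectiveEndo _ hinj').toContinuousLinearEquiv
  have he : (e : E →L[ℝ] E) = fderiv ℝ σ a := by ext v; rfl
  have hd : HasFDerivAt σ (e : E →L[ℝ] E) a := by
    rw [he]; exact (hσ.differentiableAt (by simp)).hasFDerivAt
  have hn : ((⊤ : ℕ∞) : WithTop ℕ∞) ≠ 0 := by simp
  let P := hσ.toOpenPartialHomeomorph σ hd hn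
  have hPa : a ∈ P.source := hσ.mem_toOpenPartialHomeomorph_source hd hn
  have hPt : σ a ∈ P.target := hσ.image_mem_toOpenPartialHomeomorph_target hd hn
  have hPc : ∀ x, P x = σ x := fun x => rfl
  have hsa : P.symm (σ a) = a := P.left_inv hPa
  refine ⟨P.symm, hsa, hσ.to_localInverse hd hn, ?_, ?_, ?_⟩
  · filter_upwards [P.open_source.mem_nhds hPa] with x hx using P.left_inv hx
  · filter_upwards [P.open_target.mem_nhds hPt] with x hx using P.right_inv hx
  · intro hev
    have hcont : ContinuousAt (fderiv ℝ σ) a :=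
      (hσ.fderiv_right (m := 0) (by simp)).continuousAt
    have h1 : ∀ᶠ x in 𝓝 a, fderiv ℝ σ x ∈ Set.range ((↑) : (E ≃L[ℝ] E) → E →L[ℝ] E) := by
      apply hcont
      rw [← he]
      exact ContinuousLinearEquiv.nhds e
    have hsc : Tendsto P.symm (𝓝 (σ a)) (𝓝 a) := by
      have := P.symm.continuousAt hPt
      rwa [ContinuousAt, hsa] at this
    filter_upwards [hsc.eventually hev, hsc.eventually h1, P.open_target.mem_nhds hPt] with y hy1 hy2 hy3
    obtain ⟨e', he'⟩ := hy2
    refine P.contDiffAt_symm (f₀' := e') hy3 ?_ hy1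
    rw [he']
    exact (hy1.differentiableAt (by simp)).hasFDerivAt

theorem germ_mk {E F : Type} [NormedAddCommGroup E] [NormedSpace ℝ E] [FiniteDimensional ℝ E]
    [NormedAddCommGroup F] [NormedSpace ℝ F] [FiniteDimensional ℝ F]
    {f : E → F} {a : E} {g : E → F} {b : E} (σ : E → E) (τ : F → F) (hσb : σ a = b)
    (hτb : τ (f a) = g b)
    (hσ : ContDiffAt ℝ (⊤ : ℕ∞) σ a) (hσi : ∀ v, fderiv ℝ σ a v = 0 → v = 0)
    (hτ : ContDiffAt ℝ (⊤ : ℕ∞) τ (f a)) (hτi : ∀ v, fderiv ℝ τ (f a) v = 0 → v = 0)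
    (h : ∀ᶠ x in 𝓝 a, g (σ x) = τ (f x)) : GermEquiv f a g b := by
  obtain ⟨σ', -, h2, h3, h4, -⟩ := local_inverse hσ hσi
  obtain ⟨τ', -, k2, k3, k4, -⟩ := local_inverse hτ hτi
  rw [hσb] at h2 h4
  rw [hτb] at k2 k4
  exact ⟨σ, σ', τ, τ', hσb, hτb, hσ, h2, hτ, k2, h3, h4, k3, k4, h⟩

theorem GermEquiv.trans {E F : Type} [NormedAddCommGroup E] [NormedSpace ℝ E]
    [NormedAddCommGroup F] [NormedSpace ℝ F]
    {f g h : E → F} {a b c : E}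
    (h1 : GermEquiv f a g b) (h2 : GermEquiv g b h c) : GermEquiv f a h c := by
  obtain ⟨σ, σ', τ, τ', s1, s2, s3, s4, s5, s6, s7, s8, s9, s10, s11⟩ := h1
  obtain ⟨ρ, ρ', κ, κ', t1, t2, t3, t4, t5, t6, t7, t8, t9, t10, t11⟩ := h2
  have i1 : σ' b = a := by rw [← s1]; exact s7.self_of_nhds
  have i2 : ρ' c = b := by rw [← t1]; exact t7.self_of_nhds
  have i3 : τ' (g b) = f a := by rw [← s2]; exact s9.self_of_nhds
  have i4 : κ' (h c) = g b := by rw [← t2]; exact t9.self_of_nhds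
  have c1 : Tendsto σ (𝓝 a) (𝓝 b) := by have := s3.continuousAt; rwa [ContinuousAt, s1] at this
  have c2 : Tendsto ρ' (𝓝 c) (𝓝 b) := by have := t4.continuousAt; rwa [ContinuousAt, i2] at this
  have c3 : Tendsto τ (𝓝 (f a)) (𝓝 (g b)) := by
    have := s5.continuousAt; rwa [ContinuousAt, s2] at this
  have c4 : Tendsto κ' (𝓝 (h c)) (𝓝 (g b)) := by
    have := t6.continuousAt; rwa [ContinuousAt, i4] at this
  refine ⟨ρ ∘ σ, σ' ∘ ρ', κ ∘ τ, τ' ∘ κ', by simp [s1, t1], by simp [s2, t2], ?_, ?_, ?_, ?_, ?_, ?_, ?_, ?_, ?_⟩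
  · exact ContDiffAt.comp a (by rwa [s1]) s3
  · exact ContDiffAt.comp c (by rwa [i2]) t4
  · exact ContDiffAt.comp (f a) (by rwa [s2]) s5
  · exact ContDiffAt.comp (h c) (by rwa [i4]) t6
  · filter_upwards [s7, c1.eventually t7] with x hx hy
    simp only [Function.comp, hx, hy]
  · filter_upwards [t8, c2.eventually s8] with x hx hy
    simp only [Function.comp, hx, hy]
  · filter_upwards [s9, c3.eventually t9] with x hx hy
    simp only [Function.comp, hx, hy]
  · filter_upwards [t10, c4.eventually s10] with x hx hy
    simp only [Function.comp, hx, hy]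
  · filter_upwards [s11, c1.eventually t11] with x hx hy
    simp only [Function.comp, hx, hy]

theorem GermEquiv.symm {E F : Type} [NormedAddCommGroup E] [NormedSpace ℝ E]
    [NormedAddCommGroup F] [NormedSpace ℝ F]
    {f g : E → F} {a b : E} (hf : ContinuousAt f a)
    (h1 : GermEquiv f a g b) : GermEquiv g b f a := by
  obtain ⟨σ, σ', τ, τ', s1, s2, s3, s4, s5, s6, s7, s8, s9, s10, s11⟩ := h1
  have i1 : σ' b = a := by rw [← s1]; exact s7.self_of_nhds
  have i3 : τ' (g b) = f a := by rw [← s2]; exact s9.self_of_nhds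
  have c2 : Tendsto σ' (𝓝 b) (𝓝 a) := by have := s4.continuousAt; rwa [ContinuousAt, i1] at this
  refine ⟨σ', σ, τ', τ, i1, i3, s4, s3, s6, s5, s8, s7, s10, s9, ?_⟩
  filter_upwards [s8, c2.eventually s11, (hf.tendsto.comp c2).eventually s9] with y h1 h2 h3
  simp only [Function.comp] at h3
  rw [h1] at h2
  rw [h2, h3]

/-- The cuspidal cross cap. -/
def ccap (p : ℝ × ℝ) : Fin 3 → ℝ := ![p.1, p.2 ^ 2, p.1 * p.2 ^ 3]

theorem contDiff_vec3 {E : Type} [NormedAddCommGroup E] [NormedSpace ℝ E] {f0 f1 f2 : E → ℝ} {n : WithTop ℕ∞} {x : E}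
    (h0 : ContDiffAt ℝ n f0 x) (h1 : ContDiffAt ℝ n f1 x) (h2 : ContDiffAt ℝ n f2 x) :
    ContDiffAt ℝ n (fun p => ![f0 p, f1 p, f2 p]) x := by
  rw [contDiffAt_pi]
  intro i
  fin_cases i
  · exact h0
  · exact h1
  · exact h2

theorem umbrella_ccap : GermEquiv (fun p : ℝ × ℝ =>
        ![p.1, p.2 ^ 2 + p.1 * p.2, (1/2) * p.2 ^ 4 + (1/3) * p.1 * p.2 ^ 3]) (0 : ℝ × ℝ)
    ccap 0 := by
  refine ⟨fun p => (p.1, p.2 + p.1 / 2), fun p => (p.1, p.2 - p.1 / 2),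
    fun v => ![v 0, v 1 + (v 0) ^ 2 / 4, -(3/2) * (v 2 - (v 1 + (v 0) ^ 2 / 4) ^ 2 / 2 - (v 0) ^ 2 * (v 1 + (v 0) ^ 2 / 4) / 4 + (v 0) ^ 4 / 96)],
    fun v => ![v 0, v 1 - (v 0) ^ 2 / 4, -(2/3) * v 2 + (v 1) ^ 2 / 2 + (v 0) ^ 2 * v 1 / 4 - (v 0) ^ 4 / 96], ?_, ?_, ?_, ?_, ?_, ?_, ?_, ?_, ?_, ?_, ?_⟩
  · simp
  · simp [ccap]
  · fun_prop
  · fun_prop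
  · apply contDiff_vec3 <;> fun_prop
  · apply contDiff_vec3 <;> fun_prop
  · exact Eventually.of_forall fun p => by simp
  · exact Eventually.of_forall fun p => by simp
  · refine Eventually.of_forall fun v => ?_
    ext i
    fin_cases i <;> simp
    ring
  · refine Eventually.of_forall fun v => ?_
    ext i
    fin_cases i <;> simp
    ring
  · refine Eventually.of_forall fun v => ?_
    ext i
    fin_cases i <;> simp [ccap]
    · ring
    · ring

theorem smooth_deriv {f : ℝ → ℝ} (hf : ContDiff ℝ (⊤ : ℕ∞) f) : ContDiff ℝ (⊤ : ℕ∞) (deriv f) :=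
  (contDiff_infty_iff_deriv.1 hf).2

theorem smooth_hasDerivAt {f : ℝ → ℝ} (hf : ContDiff ℝ (⊤ : ℕ∞) f) (x : ℝ) :
    HasDerivAt f (deriv f x) x := (hf.differentiable (by simp) x).hasDerivAt

theorem vanish_mul (n : ℕ) : ∀ {p h : ℝ → ℝ}, ContDiff ℝ (⊤ : ℕ∞) p →
    ContDiff ℝ (⊤ : ℕ∞) h → (∀ i < n, iteratedDeriv i p 0 = 0) →
    (∀ i < n, iteratedDeriv i (fun t => p t * h t) 0 = 0) ∧
      iteratedDeriv n (fun t => p t * h t) 0 = iteratedDeriv n p 0 * h 0 := by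
  induction n with
  | zero => intro p h hp hh _; simp
  | succ n ih =>
    intro p h hp hh hv
    have hd : deriv (fun t => p t * h t) = (fun t => deriv p t * h t) + fun t => p t * deriv h t := by
      ext t
      exact ((smooth_hasDerivAt hp t).mul (smooth_hasDerivAt hh t)).deriv
    have hp' := smooth_deriv hp
    have hh' := smooth_deriv hh
    have i1 := ih hp' hh (fun i hi => by
      rw [← iteratedDeriv_succ']; exact hv (i+1) (by omega))
    have i2 := ih hp hh' (fun i hi => hv i (by omega))
    have hadd : ∀ i, iteratedDeriv (i + 1) (fun t => p t * h t) 0 = iteratedDeriv i (fun t => deriv p t * h t) 0 + iteratedDeriv i (fun t => p t * deriv h t) 0 := by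
      intro i
      rw [iteratedDeriv_succ', hd, iteratedDeriv_add]
      · exact ((hp'.mul hh).of_le (by exact_mod_cast le_top)).contDiffAt
      · exact ((hp.mul hh').of_le (by exact_mod_cast le_top)).contDiffAt
    refine ⟨fun i hi => ?_, ?_⟩
    · rcases i with _ | i
      · have := hv 0 (by omega)
        simp only [iteratedDeriv_zero] at this
        simp [this]
      · rw [hadd, i1.1 i (by omega), i2.1 i (by omega), add_zero]
    · rw [hadd, i1.2, i2.2, hv n (by omega), ← iteratedDeriv_succ']
      ring

theorem vanish_comp {φ : ℝ → ℝ} (hφ : ContDiff ℝ (⊤ : ℕ∞) φ) (h0 : φ 0 = 0) (n : ℕ) :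
    ∀ {p : ℝ → ℝ}, ContDiff ℝ (⊤ : ℕ∞) p → (∀ i < n, iteratedDeriv i p 0 = 0) →
    (∀ i < n, iteratedDeriv i (fun t => p (φ t)) 0 = 0) ∧
      iteratedDeriv n (fun t => p (φ t)) 0 = iteratedDeriv n p 0 * deriv φ 0 ^ n := by
  induction n with
  | zero => intro p hp _; simp [h0]
  | succ n ih =>
    intro p hp hv
    have hd : deriv (fun t => p (φ t)) = (fun t => deriv p (φ t) * deriv φ t) := by
      ext t
      exact ((smooth_hasDerivAt hp (φ t)).comp t (smooth_hasDerivAt hφ t)).deriv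
    have hp' := smooth_deriv hp
    have hφ' := smooth_deriv hφ
    have i1 := ih hp' (fun i hi => by
      rw [← iteratedDeriv_succ']; exact hv (i+1) (by omega))
    have i2 := vanish_mul n (hp'.comp hφ) hφ' i1.1
    have e : (fun t => deriv p (φ t) * deriv φ t) = fun t => (deriv p ∘ φ) t * deriv φ t := rfl
    refine ⟨fun i hi => ?_, ?_⟩
    · rcases i with _ | i
      · have := hv 0 (by omega)
        simp only [iteratedDeriv_zero] at this
        simp [this, h0]
      · rw [iteratedDeriv_succ', hd, e]
        exact i2.1 i (by omega)
    · rw [iteratedDeriv_succ', hd, e, i2.2, iteratedDeriv_succ' (f := p), pow_succ]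
      have := i1.2
      change iteratedDeriv n (fun t => deriv p (φ t)) 0 * _ = _
      rw [this]
      ring

/-- Taylor remainder kernel. -/
noncomputable def rem (g : ℝ → ℝ) (q : ℝ × ℝ) : ℝ :=
  ∫ s in Set.Icc (0:ℝ) 1, (1 - s) * g (q.2 + s * (q.1 - q.2))

theorem rem_smooth {g : ℝ → ℝ} (hg : ContDiff ℝ (⊤ : ℕ∞) g) : ContDiff ℝ (⊤ : ℕ∞) (rem g) := by
  rw [contDiff_infty]
  intro n
  refine pi_compact (F := fun (s : ℝ) (q : ℝ × ℝ) => (1 - s) * g (q.2 + s * (q.1 - q.2))) isCompact_Icc measurableSet_Icc n ?_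
  fun_prop

theorem rem_taylor {a : ℝ → ℝ} (ha : ContDiff ℝ (⊤ : ℕ∞) a) (u t : ℝ) :
    a u = a t + (u - t) * deriv a t + (u - t) ^ 2 * rem (deriv (deriv a)) (u, t) := by
  have ha' := smooth_deriv ha
  have ha'' := smooth_deriv ha'
  have hd : ∀ s : ℝ, HasDerivAt (fun s => (1 - s) * (u - t) * deriv a (t + s * (u - t)) + a (t + s * (u - t)))
      ((u - t) ^ 2 * ((1 - s) * deriv (deriv a) (t + s * (u - t)))) s := by
    intro s
    have hl : HasDerivAt (fun s => t + s * (u - t)) (u - t) s := by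
      simpa using ((hasDerivAt_id s).mul_const (u - t)).const_add t
    have h1 := (smooth_hasDerivAt ha' (t + s * (u - t))).comp s hl
    have h2 := (smooth_hasDerivAt ha (t + s * (u - t))).comp s hl
    have h3 : HasDerivAt (fun s => (1 - s) * (u - t)) (-(u - t)) s := by
      simpa using ((hasDerivAt_id s).const_sub 1).mul_const (u - t)
    exact ((h3.mul h1).add h2).congr_deriv (by simp only [Function.comp]; ring)
  have hcont : Continuous fun s : ℝ => (u - t) ^ 2 * ((1 - s) * deriv (deriv a) (t + s * (u - t))) := by
    have := ha''.continuous
    fun_prop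
  have := intervalIntegral.integral_eq_sub_of_hasDerivAt (fun s _ => hd s) (hcont.intervalIntegrable 0 1)
  rw [intervalIntegral.integral_const_mul, intervalIntegral.integral_of_le zero_le_one, ← integral_Icc_eq_integral_Ioc] at this
  simp only [rem]
  rw [this]
  simp
  ring

theorem int_one_sub : ∫ s in Set.Icc (0:ℝ) 1, (1 - s) = 1 / 2 := by
  rw [integral_Icc_eq_integral_Ioc, ← intervalIntegral.integral_of_le zero_le_one]
  rw [intervalIntegral.integral_comp_sub_left (fun x => x) 1]
  norm_num

theorem int_one_sub_sq : ∫ s in Set.Icc (0:ℝ) 1, (1 - s) ^ 2 = 1 / 3 := by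
  rw [integral_Icc_eq_integral_Ioc, ← intervalIntegral.integral_of_le zero_le_one]
  rw [intervalIntegral.integral_comp_sub_left (fun x => x ^ 2) 1]
  norm_num

theorem rem_diag (g : ℝ → ℝ) (u : ℝ) : rem g (u, u) = g u / 2 := by
  simp only [rem, sub_self, mul_zero, add_zero]
  rw [integral_mul_const, int_one_sub]
  ring

theorem rem_deriv {g : ℝ → ℝ} (hg : ContDiff ℝ (⊤ : ℕ∞) g) (u : ℝ) :
    HasDerivAt (fun t => rem g (u, t)) (deriv g u / 3) u := by
  have h := pi_compact_step (F := fun (s : ℝ) (t : ℝ) => (1 - s) * g (t + s * (u - t)))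
    (isCompact_Icc (a := (0:ℝ)) (b := 1)) measurableSet_Icc (μ := volume) (by fun_prop) u
  have hf : ∀ s : ℝ, fderiv ℝ (fun t : ℝ => (1 - s) * g (t + s * (u - t))) u =
      ((1 - s) ^ 2) • (deriv g u • ContinuousLinearMap.id ℝ ℝ) := by
    intro s
    have hl : HasDerivAt (fun t => t + s * (u - t)) (1 - s) u := by
      exact ((hasDerivAt_id u).add (((hasDerivAt_id u).const_sub u).const_mul s)).congr_deriv (by ring)
    have e : u + s * (u - u) = u := by ring
    have h1 := (smooth_hasDerivAt hg (u + s * (u - u))).comp u hl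
    rw [e] at h1
    have h2 := (h1.const_mul (1 - s)).hasFDerivAt.fderiv
    simp only [Function.comp_def] at h2
    rw [h2]
    ext
    simp
    ring
  simp_rw [hf] at h
  rw [integral_smul_const, int_one_sub_sq] at h
  have := h.hasDerivAt
  refine this.congr_deriv ?_
  simp
  ring

theorem inj_vec3 {E : Type} [NormedAddCommGroup E] [NormedSpace ℝ E] {f0 f1 f2 : E → ℝ} {x : E}
    {D0 D1 D2 : E →L[ℝ] ℝ} (h0 : HasFDerivAt f0 D0 x) (h1 : HasFDerivAt f1 D1 x)
    (h2 : HasFDerivAt f2 D2 x) (hi : ∀ v, D0 v = 0 → D1 v = 0 → D2 v = 0 → v = 0) :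
    ∀ v, fderiv ℝ (fun p => ![f0 p, f1 p, f2 p]) x v = 0 → v = 0 := by
  have h : HasFDerivAt (fun p => ![f0 p, f1 p, f2 p]) (ContinuousLinearMap.pi ![D0, D1, D2]) x := by
    rw [hasFDerivAt_pi']
    intro i
    fin_cases i
    · exact h0
    · exact h1
    · exact h2
  intro v hv
  rw [h.fderiv] at hv
  exact hi v (congrFun hv 0) (congrFun hv 1) (congrFun hv 2)

theorem inj_pair {E : Type} [NormedAddCommGroup E] [NormedSpace ℝ E] {f0 f1 : E → ℝ} {x : E}
    {D0 D1 : E →L[ℝ] ℝ} (h0 : HasFDerivAt f0 D0 x) (h1 : HasFDerivAt f1 D1 x)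
    (hi : ∀ v, D0 v = 0 → D1 v = 0 → v = 0) :
    ∀ v, fderiv ℝ (fun p => (f0 p, f1 p)) x v = 0 → v = 0 := by
  intro v hv
  rw [(h0.prodMk h1).fderiv] at hv
  exact hi v (congrArg Prod.fst hv) (congrArg Prod.snd hv)

/-- Tangent map of the graph curve `(t, a t, b t)`, in the coordinates `(u, t)`, `u = t + s`. -/
noncomputable def graphTan (a b : ℝ → ℝ) (q : ℝ × ℝ) : Fin 3 → ℝ :=
  ![q.1, a q.2 + (q.1 - q.2) * deriv a q.2, b q.2 + (q.1 - q.2) * deriv b q.2]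

theorem graphTan_ccap {a b : ℝ → ℝ} (ha : ContDiff ℝ (⊤ : ℕ∞) a) (hb : ContDiff ℝ (⊤ : ℕ∞) b)
    (ha2 : 0 < deriv (deriv a) 0) (hb2 : deriv (deriv b) 0 = 0) (hb3 : deriv (deriv (deriv b)) 0 = 0)
    (hb4 : deriv (deriv (deriv (deriv b))) 0 ≠ 0) : GermEquiv (graphTan a b) 0 ccap 0 := by
  set α := deriv (deriv a) with hα
  set β := deriv (deriv b) with hβ
  have sα : ContDiff ℝ (⊤ : ℕ∞) α := smooth_deriv (smooth_deriv ha)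
  have sβ : ContDiff ℝ (⊤ : ℕ∞) β := smooth_deriv (smooth_deriv hb)
  set h := rem α with hh
  set k := rem β with hk
  have sh : ContDiff ℝ (⊤ : ℕ∞) h := rem_smooth sα
  have sk : ContDiff ℝ (⊤ : ℕ∞) k := rem_smooth sβ
  have h00 : 0 < h 0 := by
    have := rem_diag α 0
    change h 0 = _ at this
    rw [this]; linarith
  have hpos : ∀ᶠ q in 𝓝 (0 : ℝ × ℝ), 0 < h q :=
    sh.continuous.continuousAt.eventually (lt_mem_nhds h00)
  let ω : ℝ × ℝ → ℝ := fun q => (q.2 - q.1) * √(h q)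
  have sω : ∀ q, 0 < h q → ContDiffAt ℝ (⊤ : ℕ∞) ω q := fun q hq =>
    (by fun_prop : ContDiffAt ℝ (⊤ : ℕ∞) (fun q : ℝ × ℝ => q.2 - q.1) q).mul (sh.contDiffAt.sqrt hq.ne')
  have ω2 : ∀ q, 0 < h q → ω q ^ 2 = (q.1 - q.2) ^ 2 * h q := by
    intro q hq
    simp only [ω, mul_pow, Real.sq_sqrt hq.le]
    ring
  have ω0 : ω 0 = 0 := by simp [ω]
  set r := √(h 0) with hr
  have hr0 : r ≠ 0 := (Real.sqrt_pos.2 h00).ne'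
  have dω : HasFDerivAt ω (r • (ContinuousLinearMap.snd ℝ ℝ ℝ - ContinuousLinearMap.fst ℝ ℝ ℝ)) 0 := by
    have h1 : HasFDerivAt (fun q : ℝ × ℝ => q.2 - q.1) (ContinuousLinearMap.snd ℝ ℝ ℝ - ContinuousLinearMap.fst ℝ ℝ ℝ) 0 :=
      hasFDerivAt_snd.sub hasFDerivAt_fst
    have h2 : HasFDerivAt (fun q => √(h q)) (fderiv ℝ (fun q => √(h q)) 0) 0 :=
      ((sh.contDiffAt.sqrt h00.ne').differentiableAt (by simp)).hasFDerivAt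
    refine (h1.mul h2).congr_fderiv ?_
    ext <;> simp [r]
  let ψ : ℝ × ℝ → ℝ × ℝ := fun q => (q.1, ω q)
  have sψ : ∀ q, 0 < h q → ContDiffAt ℝ (⊤ : ℕ∞) ψ q := fun q hq => contDiffAt_fst.prodMk (sω q hq)
  have ψ0 : ψ 0 = 0 := by simp [ψ, ω0]
  have ψinj : ∀ v, fderiv ℝ ψ 0 v = 0 → v = 0 := by
    refine inj_pair hasFDerivAt_fst dω fun v h1 h2 => ?_
    simp only [ContinuousLinearMap.coe_fst', ContinuousLinearMap.smul_apply, ContinuousLinearMap.sub_apply, ContinuousLinearMap.coe_snd', smul_eq_mul, mul_eq_zero, hr0, false_or] at h1 h2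
    ext
    · simpa using h1
    · simp; linarith
  obtain ⟨Θ, Θ0, sΘ0, Θl, Θr, sΘ⟩ := local_inverse (sψ 0 h00) ψinj
  replace sΘ := sΘ (hpos.mono sψ)
  rw [ψ0] at Θ0 Θr sΘ sΘ0
  have Θt : Tendsto Θ (𝓝 0) (𝓝 0) := by
    have := sΘ0.continuousAt
    rwa [ContinuousAt, Θ0] at this
  have sK : ∀ᶠ p in 𝓝 (0 : ℝ × ℝ), ContDiffAt ℝ (⊤ : ℕ∞) (fun p => k (Θ p) / h (Θ p)) p := by
    filter_upwards [sΘ, Θt.eventually hpos] with p h1 h2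
    exact (sk.contDiffAt.comp p h1).div (sh.contDiffAt.comp p h1) h2.ne'
  obtain ⟨K, sK', hKc, hKe⟩ := cutoff_extend sK
  obtain ⟨A, B, sA, sB, hAB⟩ := whitney sK' hKc
  have ψt : Tendsto ψ (𝓝 0) (𝓝 0) := by
    have := (sψ 0 h00).continuousAt
    rwa [ContinuousAt, ψ0] at this
  -- the key factorization
  have key : ∀ᶠ q in 𝓝 (0 : ℝ × ℝ), k q = h q * (A (q.1, ω q ^ 2) + ω q * B (q.1, ω q ^ 2)) := by
    filter_upwards [ψt.eventually hKe, Θl, hpos] with q h1 h2 h3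
    rw [← hAB]
    change k q = h q * K (ψ q)
    rw [h1, h2]
    field_simp
  have dA : ∀ p, HasFDerivAt A (fderiv ℝ A p) p := fun p => (sA.differentiable (by simp) p).hasFDerivAt
  have dB : ∀ p, HasFDerivAt B (fderiv ℝ B p) p := fun p => (sB.differentiable (by simp) p).hasFDerivAt
  -- restriction to the diagonal
  have hdiag : Tendsto (fun u : ℝ => (u, u)) (𝓝 0) (𝓝 (0 : ℝ × ℝ)) :=
    (by fun_prop : Continuous fun u : ℝ => (u, u)).tendsto' 0 0 rfl
  have hB0 : ∀ᶠ u in 𝓝 (0 : ℝ), 3 * α u * (α u / 2 * √(α u / 2)) * B (u, 0) =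
      deriv β u * α u - deriv α u * β u := by
    filter_upwards [hdiag.eventually key.eventually_nhds, hdiag.eventually hpos] with u h1 h2
    have hk0 : β u / 2 = α u / 2 * A (u, 0) := by
      have := h1.self_of_nhds
      simp only [ω, sub_self, zero_mul, hk, hh, rem_diag] at this
      simpa using this
    have huu : h (u, u) = α u / 2 := rem_diag α u
    have hl : HasDerivAt (fun t : ℝ => (u, t)) ((0 : ℝ), (1 : ℝ)) u := (hasDerivAt_const u u).prodMk (hasDerivAt_id u)
    have e1 : HasDerivAt (fun t => k (u, t)) (deriv β u / 3) u := rem_deriv sβ u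
    have e2 : HasDerivAt (fun t => h (u, t)) (deriv α u / 3) u := rem_deriv sα u
    have e3 : HasDerivAt (fun t => ω (u, t)) (√(α u / 2)) u := by
      have := ((hasDerivAt_id u).sub_const u).mul (e2.sqrt h2.ne')
      refine this.congr_deriv ?_
      simp [huu]
    have ωu : ω (u, u) = 0 := by simp [ω]
    have e4 : HasDerivAt (fun t => (u, ω (u, t) ^ 2)) ((0 : ℝ), (0 : ℝ)) u := by
      refine ((hasDerivAt_const u u).prodMk (e3.pow 2)).congr_deriv ?_
      simp [ωu]
    have e5 : HasDerivAt (fun t => A (u, ω (u, t) ^ 2)) 0 u := by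
      have := (dA (u, ω (u, u) ^ 2)).comp_hasDerivAt u e4
      exact this.congr_deriv (map_zero (fderiv ℝ A (u, ω (u, u) ^ 2)))
    have e6 : HasDerivAt (fun t => B (u, ω (u, t) ^ 2)) 0 u := by
      have := (dB (u, ω (u, u) ^ 2)).comp_hasDerivAt u e4
      exact this.congr_deriv (map_zero (fderiv ℝ B (u, ω (u, u) ^ 2)))
    have e7 := e2.mul (e5.add (e3.mul e6))
    have e8 : (fun t => k (u, t)) =ᶠ[𝓝 u] fun t => h (u, t) * (A (u, ω (u, t) ^ 2) + ω (u, t) * B (u, ω (u, t) ^ 2)) :=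
      hl.continuousAt.tendsto.eventually h1
    have e9 := (e1.congr_of_eventuallyEq e8.symm).unique e7
    have e10 : deriv β u / 3 = deriv α u / 3 * A (u, 0) + α u / 2 * (√(α u / 2) * B (u, 0)) := by
      rw [e9]
      generalize √(α u / 2) = ρ
      simp [ωu, huu]
    linear_combination (-3 * α u) * e10 + 2 * deriv α u * hk0
  have dB0 : HasDerivAt (fun u => B (u, 0)) (fderiv ℝ B 0 (1, 0)) 0 := by
    have hl : HasDerivAt (fun t : ℝ => (t, (0:ℝ))) ((1 : ℝ), (0 : ℝ)) 0 := (hasDerivAt_id 0).prodMk (hasDerivAt_const 0 0)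
    exact HasFDerivAt.comp_hasDerivAt (f := fun t : ℝ => (t, (0:ℝ))) (0:ℝ) (dB ((0:ℝ), (0:ℝ))) hl
  have B00 : B (0, 0) = 0 := by
    have := hB0.self_of_nhds
    rw [hb2, hb3] at this
    have h1 : 0 < 3 * α 0 * (α 0 / 2 * √(α 0 / 2)) := by positivity
    exact (mul_eq_zero.1 (this.trans (by ring))).resolve_left h1.ne'
  have Bu : fderiv ℝ B 0 (1, 0) ≠ 0 := by
    intro h0
    rw [h0] at dB0
    have sD : HasDerivAt (fun u => 3 * α u * (α u / 2 * √(α u / 2))) (deriv (fun u => 3 * α u * (α u / 2 * √(α u / 2))) 0) 0 := by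
      have h1 : DifferentiableAt ℝ α 0 := sα.differentiable (by simp) 0
      have h2 : DifferentiableAt ℝ (fun u => √(α u / 2)) 0 := (h1.div_const 2).sqrt (by positivity)
      exact ((h1.const_mul 3).mul ((h1.div_const 2).mul h2)).hasDerivAt
    have f1 := sD.mul dB0
    have f2 := ((smooth_hasDerivAt (smooth_deriv sβ) 0).mul (smooth_hasDerivAt sα 0)).sub
      ((smooth_hasDerivAt (smooth_deriv sα) 0).mul (smooth_hasDerivAt sβ 0))
    have f3 := (f1.congr_of_eventuallyEq (hB0.mono fun u hu => hu.symm)).unique f2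
    rw [B00, hb2, hb3] at f3
    simp at f3
    rcases f3 with f3 | f3
    · exact hb4 f3
    · exact ha2.ne' f3
  have dBlin : ∀ x : ℝ, fderiv ℝ B 0 (x, 0) = x * fderiv ℝ B 0 (1, 0) := by
    intro x
    have : (x, (0:ℝ)) = x • ((1 : ℝ), (0 : ℝ)) := by simp
    rw [this, map_smul, smul_eq_mul]
  have dω2 : HasFDerivAt (fun q => ω q ^ 2) (0 : ℝ × ℝ →L[ℝ] ℝ) 0 := by
    refine (dω.pow 2).congr_fderiv ?_
    simp [ω0]
  have P0 : graphTan a b 0 = ![0, a 0, b 0] := by simp [graphTan]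
  refine germ_mk (fun q => (B (q.1, ω q ^ 2), ω q))
    (fun v => ![B (v 0, a (v 0) - v 1), a (v 0) - v 1, b (v 0) - (a (v 0) - v 1) * A (v 0, a (v 0) - v 1) - v 2])
    ?_ ?_ ?_ ?_ ?_ ?_ ?_
  · ext <;> simp [ω0, B00]
  · rw [P0]
    ext i
    fin_cases i <;> simp [ccap, B00]
  · exact (sB.contDiffAt.comp 0 (contDiffAt_fst.prodMk ((sω 0 h00).pow 2))).prodMk (sω 0 h00)
  · have d1 : HasFDerivAt (fun q : ℝ × ℝ => B (q.1, ω q ^ 2)) ((fderiv ℝ B 0).comp ((ContinuousLinearMap.fst ℝ ℝ ℝ).prod 0)) 0 := by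
      have := dB ((0 : ℝ × ℝ).1, ω 0 ^ 2)
      have e : ((0 : ℝ × ℝ).1, ω 0 ^ 2) = (0 : ℝ × ℝ) := by ext <;> simp [ω0]
      have h3 := this.comp (0 : ℝ × ℝ) (hasFDerivAt_fst.prodMk dω2)
      rw [e] at h3
      exact h3
    refine inj_pair d1 dω fun v h1 h2 => ?_
    have h1' : fderiv ℝ B 0 (v.1, 0) = 0 := h1
    rw [dBlin, mul_eq_zero] at h1'
    replace h1 : v.1 = 0 := h1'.resolve_right Bu
    replace h2 : r * (v.2 - v.1) = 0 := h2
    rw [mul_eq_zero] at h2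
    replace h2 := h2.resolve_left hr0
    ext
    · simpa using h1
    · simp; linarith
  · apply contDiff_vec3 <;> fun_prop
  · rw [P0]
    let x : Fin 3 → ℝ := ![0, a 0, b 0]
    let pr : Fin 3 → ((Fin 3 → ℝ) →L[ℝ] ℝ) := fun i => ContinuousLinearMap.proj i
    have dp : ∀ i, HasFDerivAt (fun v : Fin 3 → ℝ => v i) (pr i) x := fun i => (pr i).hasFDerivAt
    have x0 : x 0 = 0 := rfl
    have x1 : x 1 = a 0 := rfl
    have dV : HasFDerivAt (fun v : Fin 3 → ℝ => a (v 0) - v 1) (deriv a 0 • pr 0 - pr 1) x :=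
      ((smooth_hasDerivAt ha (x 0)).comp_hasFDerivAt x (dp 0)).sub (dp 1)
    have e : (x 0, a (x 0) - x 1) = (0 : ℝ × ℝ) := by ext <;> simp [x0, x1]
    have dBx : HasFDerivAt (fun v : Fin 3 → ℝ => B (v 0, a (v 0) - v 1)) ((fderiv ℝ B 0).comp ((pr 0).prod (deriv a 0 • pr 0 - pr 1))) x := by
      have h3 := (dB (x 0, a (x 0) - x 1)).comp x ((dp 0).prodMk dV)
      rw [e] at h3
      exact h3
    have dAx : HasFDerivAt (fun v : Fin 3 → ℝ => A (v 0, a (v 0) - v 1)) ((fderiv ℝ A 0).comp ((pr 0).prod (deriv a 0 • pr 0 - pr 1))) x := by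
      have h3 := (dA (x 0, a (x 0) - x 1)).comp x ((dp 0).prodMk dV)
      rw [e] at h3
      exact h3
    have dbx : HasFDerivAt (fun v : Fin 3 → ℝ => b (v 0)) (deriv b 0 • pr 0) x :=
      (smooth_hasDerivAt hb (x 0)).comp_hasFDerivAt x (dp 0)
    refine inj_vec3 dBx dV ((dbx.sub (dV.mul dAx)).sub (dp 2)) fun v h1 h2 h3 => ?_
    have g1 : v 0 = 0 := by
      rw [ContinuousLinearMap.comp_apply, ContinuousLinearMap.prod_apply, h2] at h1
      rw [dBlin, mul_eq_zero] at h1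
      exact h1.resolve_right Bu
    have g2 : v 1 = 0 := by
      simp [pr, g1] at h2
      exact h2
    have g3 : v 2 = 0 := by
      simp [pr, g1, g2, x0, x1] at h3
      exact h3
    ext i
    fin_cases i
    · exact g1
    · exact g2
    · exact g3
  · filter_upwards [key, hpos] with q h1 h2
    have t1 := rem_taylor ha q.1 q.2
    have t2 := rem_taylor hb q.1 q.2
    have w2 := ω2 q h2
    change a q.1 = _ + _ * h q at t1
    change b q.1 = _ + _ * k q at t2
    have V : a q.1 - (a q.2 + (q.1 - q.2) * deriv a q.2) = ω q ^ 2 := by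
      rw [w2, t1]; ring
    ext i
    fin_cases i
    · simp [ccap, graphTan, V]
    · simp [ccap, graphTan, V]
    · simp [ccap, graphTan, V]
      rw [h1] at t2
      linear_combination (-(A (q.1, ω q ^ 2) + ω q * B (q.1, ω q ^ 2))) * (-w2) - t2

theorem iteratedDeriv_clm {F : Type} [NormedAddCommGroup F] [NormedSpace ℝ F]
    (l : F →L[ℝ] ℝ) {γ : ℝ → F} (hγ : ContDiff ℝ (⊤ : ℕ∞) γ) (n : ℕ) :
    iteratedDeriv n (fun t => l (γ t)) = fun t => l (iteratedDeriv n γ t) := by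
  induction n with
  | zero => simp
  | succ n ih =>
    ext t
    rw [iteratedDeriv_succ, ih, iteratedDeriv_succ]
    have h : DifferentiableAt ℝ (iteratedDeriv n γ) t :=
      (hγ.differentiable_iteratedDeriv n (by exact_mod_cast WithTop.coe_lt_top n)) t
    exact (l.hasFDerivAt.comp_hasDerivAt t h.hasDerivAt).deriv

theorem tan_graph (γ : ℝ → Fin 3 → ℝ) (hγ : ContDiff ℝ (⊤ : ℕ∞) γ)
    (hind : LinearIndependent ℝ ![iteratedDeriv 1 γ 0, iteratedDeriv 2 γ 0])
    (h3 : iteratedDeriv 3 γ 0 ∈ Submodule.span ℝ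
      ({iteratedDeriv 1 γ 0, iteratedDeriv 2 γ 0} : Set (Fin 3 → ℝ)))
    (h4 : iteratedDeriv 4 γ 0 ∉ Submodule.span ℝ
      ({iteratedDeriv 1 γ 0, iteratedDeriv 2 γ 0} : Set (Fin 3 → ℝ))) :
    ∃ a b : ℝ → ℝ, ContDiff ℝ (⊤ : ℕ∞) a ∧ ContDiff ℝ (⊤ : ℕ∞) b ∧
      0 < deriv (deriv a) 0 ∧ deriv (deriv b) 0 = 0 ∧ deriv (deriv (deriv b)) 0 = 0 ∧
      deriv (deriv (deriv (deriv b))) 0 ≠ 0 ∧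
      GermEquiv (fun p : ℝ × ℝ => γ p.2 + p.1 • deriv γ p.2) (0 : ℝ × ℝ) (graphTan a b) 0 := by
  -- adapted linear coordinates
  obtain ⟨L, L1, L2, L4⟩ : ∃ L : (Fin 3 → ℝ) ≃L[ℝ] (Fin 3 → ℝ), L (iteratedDeriv 1 γ 0) = ![1, 0, 0] ∧
      L (iteratedDeriv 2 γ 0) = ![0, 1, 0] ∧ L (iteratedDeriv 4 γ 0) = ![0, 0, 1] := by
    have hli : LinearIndependent ℝ (Fin.snoc ![iteratedDeriv 1 γ 0, iteratedDeriv 2 γ 0] (iteratedDeriv 4 γ 0) : Fin 3 → Fin 3 → ℝ) := by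
      rw [linearIndependent_finSnoc]
      refine ⟨hind, ?_⟩
      simpa [Matrix.range_cons, Set.pair_comm] using h4
    let B := basisOfLinearIndependentOfCardEqFinrank hli (by simp)
    have hB : ∀ i, B i = (Fin.snoc ![iteratedDeriv 1 γ 0, iteratedDeriv 2 γ 0] (iteratedDeriv 4 γ 0) : Fin 3 → Fin 3 → ℝ) i := by
      intro i; simp [B]
    have k : ∀ i, B.equivFunL (B i) = Pi.single i 1 := by
      intro i
      ext j
      simp [Module.Basis.equivFunL, Pi.single_apply, Finsupp.single_apply, eq_comm]
    refine ⟨B.equivFunL, ?_, ?_, ?_⟩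
    · have := k 0
      rw [hB] at this
      refine Eq.trans this ?_
      ext j; fin_cases j <;> simp
    · have := k 1
      rw [hB] at this
      refine Eq.trans this ?_
      ext j; fin_cases j <;> simp
    · have := k 2
      rw [hB] at this
      refine Eq.trans this ?_
      ext j; fin_cases j <;> simp
  have L3 : L (iteratedDeriv 3 γ 0) 2 = 0 := by
    obtain ⟨c, d, hcd⟩ := Submodule.mem_span_pair.1 h3
    rw [← hcd, map_add, map_smul, map_smul, L1, L2]
    simp
  let l : Fin 3 → ((Fin 3 → ℝ) →L[ℝ] ℝ) := fun i => (ContinuousLinearMap.proj i).comp (L : (Fin 3 → ℝ) →L[ℝ] (Fin 3 → ℝ))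
  have hl : ∀ i v, l i v = L v i := fun i v => rfl
  let X : Fin 3 → ℝ → ℝ := fun i t => l i (γ t) - l i (γ 0)
  have sX : ∀ i, ContDiff ℝ (⊤ : ℕ∞) (X i) := fun i => ((l i).contDiff.comp hγ).sub contDiff_const
  have X0 : ∀ i, X i 0 = 0 := fun i => by simp [X]
  have dX : ∀ i, deriv (X i) = fun t => l i (deriv γ t) := by
    intro i
    ext t
    have h := ((hγ.differentiable (by simp)) t).hasDerivAt
    exact (((l i).hasFDerivAt.comp_hasDerivAt t h).sub_const _).deriv
  have sγ' : ContDiff ℝ (⊤ : ℕ∞) (deriv γ) := (contDiff_infty_iff_deriv.1 hγ).2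
  have itX : ∀ i n, iteratedDeriv n (deriv (X i)) 0 = L (iteratedDeriv (n + 1) γ 0) i := by
    intro i n
    rw [dX, iteratedDeriv_clm (l i) sγ', ← iteratedDeriv_succ']
    rfl
  have dX0 : deriv (X 0) 0 = 1 := by
    have := itX 0 0
    rw [iteratedDeriv_zero, L1] at this
    simpa using this
  have dX1 : deriv (X 1) 0 = 0 := by
    have := itX 1 0
    rw [iteratedDeriv_zero, L1] at this
    simpa using this
  have dX2 : deriv (X 2) 0 = 0 := by
    have := itX 2 0
    rw [iteratedDeriv_zero, L1] at this
    simpa using this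
  -- invert the first coordinate
  have hinj : ∀ v, fderiv ℝ (X 0) 0 v = 0 → v = 0 := by
    intro v hv
    rw [(smooth_hasDerivAt (sX 0) 0).hasFDerivAt.fderiv] at hv
    simpa [dX0] using hv
  obtain ⟨φ₀, p1, p2, p3, p4, p5⟩ := local_inverse (sX 0).contDiffAt hinj
  replace p5 := p5 (Eventually.of_forall fun t => (sX 0).contDiffAt)
  rw [X0] at p1 p2 p4 p5
  obtain ⟨φ, sφ, -, hφ⟩ := cutoff_extend p5
  have φ0 : φ 0 = 0 := hφ.self_of_nhds.trans p1
  have Xt : Tendsto (X 0) (𝓝 0) (𝓝 0) := (sX 0).continuous.tendsto' 0 0 (X0 0)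
  have φX : ∀ᶠ t in 𝓝 (0 : ℝ), φ (X 0 t) = t := by
    filter_upwards [p3, Xt.eventually hφ] with t h1 h2
    rw [h2, h1]
  have Xφ : ∀ᶠ t in 𝓝 (0 : ℝ), X 0 (φ t) = t := by
    filter_upwards [p4, hφ] with t h1 h2
    rw [h2, h1]
  have dφ0 : deriv φ 0 = 1 := by
    have h1 := (smooth_hasDerivAt (sX 0) (φ 0)).comp 0 (smooth_hasDerivAt sφ 0)
    have h2 := ((hasDerivAt_id (0:ℝ)).congr_of_eventuallyEq (f₁ := X 0 ∘ φ) Xφ).unique h1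
    rw [φ0, dX0] at h2
    linarith
  have sφ' := smooth_deriv sφ
  let c : Fin 3 → ℝ → ℝ := fun i t => X i (φ t)
  have sc : ∀ i, ContDiff ℝ (⊤ : ℕ∞) (c i) := fun i => (sX i).comp sφ
  have dc : ∀ i, deriv (c i) = fun t => deriv (X i) (φ t) * deriv φ t := fun i => by
    ext t
    exact ((smooth_hasDerivAt (sX i) (φ t)).comp t (smooth_hasDerivAt sφ t)).deriv
  have van : ∀ i n, (∀ j < n, iteratedDeriv j (deriv (X i)) 0 = 0) →
      (∀ j < n, iteratedDeriv j (deriv (c i)) 0 = 0) ∧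
      iteratedDeriv n (deriv (c i)) 0 = iteratedDeriv n (deriv (X i)) 0 := by
    intro i n hv
    have v1 := vanish_comp sφ φ0 n (smooth_deriv (sX i)) hv
    have v2 := vanish_mul n ((smooth_deriv (sX i)).comp sφ) sφ' v1.1
    rw [dc]
    refine ⟨v2.1, v2.2.trans ?_⟩
    have := v1.2
    rw [dφ0] at this ⊢
    rw [mul_one]
    refine Eq.trans this ?_
    simp
  have van1 := van 1 1 (by
    intro j hj
    interval_cases j
    rw [iteratedDeriv_zero, dX1])
  have van2 := van 2 3 (by
    intro j hj
    rw [itX]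
    interval_cases j
    · rw [L1]; simp
    · rw [L2]; simp
    · exact L3)
  rw [itX, L2] at van1
  rw [itX, L4] at van2
  have a2 : deriv (deriv (c 1)) 0 = 1 := by simpa [iteratedDeriv_succ] using van1.2
  have b2 : deriv (deriv (c 2)) 0 = 0 := by simpa [iteratedDeriv_succ] using van2.1 1 (by norm_num)
  have b3 : deriv (deriv (deriv (c 2))) 0 = 0 := by simpa [iteratedDeriv_succ] using van2.1 2 (by norm_num)
  have b4 : deriv (deriv (deriv (deriv (c 2)))) 0 = 1 := by simpa [iteratedDeriv_succ] using van2.2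
  have cX : ∀ i, ∀ᶠ t in 𝓝 (0 : ℝ), c i (X 0 t) = X i t := by
    intro i
    filter_upwards [φX] with t ht
    simp only [c, ht]
  have dcX : ∀ i, ∀ᶠ t in 𝓝 (0 : ℝ), deriv (c i) (X 0 t) * deriv (X 0) t = deriv (X i) t := by
    intro i
    filter_upwards [(cX i).eventually_nhds] with t ht
    have h1 := (smooth_hasDerivAt (sc i) (X 0 t)).comp t (smooth_hasDerivAt (sX 0) t)
    have h2 := smooth_hasDerivAt (sX i) t
    exact (h1.congr_of_eventuallyEq (f₁ := X i) (ht.mono fun s hs => hs.symm)).unique h2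
  refine ⟨c 1, c 2, sc 1, sc 2, by rw [a2]; norm_num, b2, b3, by rw [b4]; norm_num, ?_⟩
  have c0 : ∀ i, c i 0 = 0 := fun i => by simp only [c, φ0, X0]
  have dXs := smooth_deriv (sX 0)
  have s0 := sX 0
  refine germ_mk (fun q => (X 0 q.2 + q.1 * deriv (X 0) q.2, X 0 q.2)) (fun v => L (v - γ 0)) ?_ ?_ ?_ ?_ ?_ ?_ ?_
  · simp [X0]
  · ext i
    fin_cases i <;> simp [graphTan, c0]
  · fun_prop
  · have d1 : HasFDerivAt (fun q : ℝ × ℝ => X 0 q.2) (deriv (X 0) 0 • ContinuousLinearMap.snd ℝ ℝ ℝ) 0 :=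
      HasDerivAt.comp_hasFDerivAt (0 : ℝ × ℝ) (smooth_hasDerivAt (sX 0) (0 : ℝ × ℝ).2) hasFDerivAt_snd
    have d2 : HasFDerivAt (fun q : ℝ × ℝ => deriv (X 0) q.2) (deriv (deriv (X 0)) 0 • ContinuousLinearMap.snd ℝ ℝ ℝ) 0 :=
      HasDerivAt.comp_hasFDerivAt (0 : ℝ × ℝ) (smooth_hasDerivAt dXs (0 : ℝ × ℝ).2) hasFDerivAt_snd
    refine inj_pair (d1.add (hasFDerivAt_fst.mul d2)) d1 fun v h1 h2 => ?_
    simp [dX0] at h1 h2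
    ext
    · simp; linarith
    · simpa using h2
  · fun_prop
  · intro v hv
    have : HasFDerivAt (fun v => L (v - γ 0)) (L : (Fin 3 → ℝ) →L[ℝ] (Fin 3 → ℝ)) (γ (0 : ℝ × ℝ).2 + (0 : ℝ × ℝ).1 • deriv γ (0 : ℝ × ℝ).2) :=
      (L : (Fin 3 → ℝ) →L[ℝ] (Fin 3 → ℝ)).hasFDerivAt.comp _ ((hasFDerivAt_id _).sub_const _)
    rw [this.fderiv] at hv
    exact (map_eq_zero_iff L L.injective).1 hv
  · have ht : Tendsto (fun q : ℝ × ℝ => q.2) (𝓝 0) (𝓝 0) := continuous_snd.tendsto' _ _ rfl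
    filter_upwards [ht.eventually (cX 1), ht.eventually (cX 2), ht.eventually (dcX 1), ht.eventually (dcX 2)] with q q1 q2 q3 q4
    have e : ∀ i, L (γ q.2 + q.1 • deriv γ q.2 - γ 0) i = X i q.2 + q.1 * deriv (X i) q.2 := by
      intro i
      rw [dX, ← hl]
      simp only [X, map_sub, map_add, map_smul, smul_eq_mul]
      ring
    ext i
    rw [e]
    fin_cases i
    · simp [graphTan]
    · simp [graphTan, q1]
      rw [← q3]; ring
    · simp [graphTan, q2]
      rw [← q4]; ring

/-- The tangent variety to a curve `γ` of type `(1,2,4)` at `0` is locally diffeomorphic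
to the folded umbrella `(u, x) ↦ (u, x² + ux, (1/2)x⁴ + (1/3)ux³)`. -/
theorem tangent_variety_type_124_folded_umbrella
    (γ : ℝ → Fin 3 → ℝ) (hγ : ContDiff ℝ (⊤ : ℕ∞) γ)
    (hind : LinearIndependent ℝ ![iteratedDeriv 1 γ 0, iteratedDeriv 2 γ 0])
    (h3 : iteratedDeriv 3 γ 0 ∈ Submodule.span ℝ
      ({iteratedDeriv 1 γ 0, iteratedDeriv 2 γ 0} : Set (Fin 3 → ℝ)))
    (h4 : iteratedDeriv 4 γ 0 ∉ Submodule.span ℝ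
      ({iteratedDeriv 1 γ 0, iteratedDeriv 2 γ 0} : Set (Fin 3 → ℝ))) :
    GermEquiv (fun p : ℝ × ℝ => γ p.2 + p.1 • deriv γ p.2) (0 : ℝ × ℝ)
      (fun p : ℝ × ℝ =>
        ![p.1, p.2 ^ 2 + p.1 * p.2, (1/2) * p.2 ^ 4 + (1/3) * p.1 * p.2 ^ 3]) (0 : ℝ × ℝ) := by
  obtain ⟨a, b, ha, hb, a2, b2, b3, b4, hG⟩ := tan_graph γ hγ hind h3 h4
  have hu : ContinuousAt (fun p : ℝ × ℝ =>
      ![p.1, p.2 ^ 2 + p.1 * p.2, (1/2) * p.2 ^ 4 + (1/3) * p.1 * p.2 ^ 3]) (0 : ℝ × ℝ) := by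
    refine (ContDiffAt.continuousAt (𝕜 := ℝ) (n := 1) ?_)
    apply contDiff_vec3 <;> fun_prop
  exact (hG.trans (graphTan_ccap ha hb a2 b2 b3 b4)).trans (umbrella_ccap.symm hu)
end
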